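/- arXiv:0710.0267 — 2 statements merged into one kernel-verified Lean document; each statement's English description precedes it below -/
import Mathlib

section
/- Let A be a real von Neumann regular poring (not assumed Baer). Then A has a unique real closure * if and only if there exists a subset X ⊆ Sper A such that, for every epof B of A and every ideal I of B making A → B → B/I an essential extension of A, one has X = {α ∈ Sper A : ρ(α) is (A/supp(α))-isomorphic to the integral closure of A/supp(α) in B/p for some prime ideal p of B containing I and the ideal generated by supp(α)}. -/
universe u

/-- A partial ordering (positive cone) of a commutative ring: closed under addition and
multiplication, contains all squares, and intersects its negative only in `0`. -/
def IsPartialOrdering {A : Type*} [CommRing A] (P : Set A) : Prop :=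
  (∀ a ∈ P, ∀ b ∈ P, a + b ∈ P) ∧ (∀ a ∈ P, ∀ b ∈ P, a * b ∈ P) ∧
  (∀ a : A, a ^ 2 ∈ P) ∧ (∀ a ∈ P, -a ∈ P → a = 0)

/-- A (formally) real ring: a sum of squares vanishes only if each term vanishes. -/
def IsRealRing (A : Type*) [CommRing A] : Prop :=
  ∀ (n : ℕ) (f : Fin n → A), (∑ i, f i ^ 2) = 0 → ∀ i, f i = 0

/-- A von Neumann regular commutative ring. -/
def IsVonNeumannRegular (A : Type*) [CommRing A] : Prop :=
  ∀ a : A, ∃ b : A, a = a ^ 2 * b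

/-- A Baer ring: the annihilator of every subset is generated by an idempotent. -/
def IsBaerRing (A : Type*) [CommRing A] : Prop :=
  ∀ S : Set A, ∃ e : A, e * e = e ∧ ∀ x : A, (∀ s ∈ S, x * s = 0) ↔ ∃ y : A, x = e * y

/-- An essential (ring) extension: an injective ring homomorphism such that every nonzero
ideal of the codomain meets the image of the domain nontrivially. -/
def IsEssentialExtension {A B : Type*} [CommRing A] [CommRing B] (f : A →+* B) : Prop :=
  Function.Injective f ∧ ∀ J : Ideal B, J ≠ ⊥ → ∃ a : A, f a ∈ J ∧ f a ≠ 0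

/-- A real ring is real closed * if it admits no proper essential integral extension
which is again a real ring. -/
def IsRealClosedStar (B : Type u) [CommRing B] : Prop :=
  IsRealRing B ∧ ∀ (C : Type u) [CommRing C] (f : B →+* C),
    IsRealRing C → IsEssentialExtension f → f.IsIntegral → Function.Surjective f

/-- `(B, Q)` together with the embedding `f` is a real closure * of the poring `(A, P)`:
`B` is a real closed * ring, an essential and integral extension of `A`, whose partial
ordering `Q` extends `P`. -/
structure IsRealClosureStarOf (A : Type u) [CommRing A] (P : Set A)
    (B : Type u) [CommRing B] (Q : Set B) (f : A →+* B) : Prop where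
  pos_partial : IsPartialOrdering Q
  rcs : IsRealClosedStar B
  essential : IsEssentialExtension f
  integral : f.IsIntegral
  mono : ∀ a ∈ P, f a ∈ Q

/-- Bundled real closure * of a poring `(A, P)`. -/
structure RealClosureStar (A : Type u) [CommRing A] (P : Set A) : Type (u + 1) where
  carrier : Type u
  [ring : CommRing carrier]
  pos : Set carrier
  emb : A →+* carrier
  is : IsRealClosureStarOf A P carrier pos emb

attribute [instance] RealClosureStar.ring

/-- Two real closures * of `(A, P)` are `A`-isomorphic: there is a ring isomorphism over
`A` preserving the partial orderings in both directions. -/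
def RealClosureStar.AIso {A : Type u} [CommRing A] {P : Set A}
    (B C : RealClosureStar A P) : Prop :=
  ∃ e : B.carrier ≃+* C.carrier, (∀ a : A, e (B.emb a) = C.emb a) ∧
    ∀ b : B.carrier, b ∈ B.pos ↔ e b ∈ C.pos

/-- A poring `(A, P)` has a unique real closure *: one exists, and any two are
`A`-isomorphic as porings. -/
def HasUniqueRealClosureStar (A : Type u) [CommRing A] (P : Set A) : Prop :=
  Nonempty (RealClosureStar A P) ∧ ∀ B C : RealClosureStar A P, B.AIso C

/-- A prime cone of a commutative ring. -/
structure PrimeCone (A : Type u) [CommRing A] : Type u where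
  carrier : Set A
  add_mem : ∀ a ∈ carrier, ∀ b ∈ carrier, a + b ∈ carrier
  mul_mem : ∀ a ∈ carrier, ∀ b ∈ carrier, a * b ∈ carrier
  sq_mem : ∀ a : A, a ^ 2 ∈ carrier
  mem_or_neg_mem : ∀ a : A, a ∈ carrier ∨ -a ∈ carrier
  support : Ideal A
  mem_support : ∀ a : A, a ∈ support ↔ a ∈ carrier ∧ -a ∈ carrier
  support_isPrime : support.IsPrime

/-- The real spectrum of a poring `(A, P)`: the prime cones containing `P`. -/
def RealSpectrum (A : Type u) [CommRing A] (P : Set A) : Type u :=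
  {α : PrimeCone A // P ⊆ α.carrier}

/-- A real closed field: formally real, every element or its negative is a square, and
every polynomial of odd degree has a root. -/
def IsRealClosedField (F : Type u) [Field F] : Prop :=
  IsRealRing F ∧ (∀ x : F, (∃ y : F, y ^ 2 = x) ∨ ∃ y : F, y ^ 2 = -x) ∧
    ∀ p : Polynomial F, Odd p.natDegree → ∃ x : F, Polynomial.eval x p = 0

/-- A total ordering (positive cone) of a ring. -/
def IsTotalOrderingCone {K : Type*} [CommRing K] (T : Set K) : Prop :=
  (∀ a ∈ T, ∀ b ∈ T, a + b ∈ T) ∧ (∀ a ∈ T, ∀ b ∈ T, a * b ∈ T) ∧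
  (∀ x : K, x ∈ T ∨ -x ∈ T) ∧ ∀ x ∈ T, -x ∈ T → x = 0

/-- The data `(K, κ)` is an epof (extension of product of fields) of the poring `(A, P)`:
for each prime `p` of `A`, `K p` is a real closed field, algebraic over `Frac (A / p)`
(i.e. every element is algebraic over the image of `A` under `κ p`, whose kernel is `p`),
whose unique ordering (the squares) extends the image of `P` in `A / p`.  The epof itself
is the product `∀ p, K p` with the embedding `Pi.ringHom κ` and partial ordering the
squares. -/
structure IsEpof (A : Type u) [CommRing A] (P : Set A)
    (K : PrimeSpectrum A → Type u) [∀ p, Field (K p)] (κ : ∀ p, A →+* K p) : Prop where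
  ker : ∀ (p : PrimeSpectrum A) (a : A), κ p a = 0 ↔ a ∈ p.asIdeal
  rcf : ∀ p, IsRealClosedField (K p)
  alg : ∀ (p) (x : K p), ∃ q : Polynomial A,
    Polynomial.eval₂ (κ p) x q = 0 ∧ q.map (κ p) ≠ 0
  ordext : ∀ p, ∀ a ∈ P, ∃ y : K p, y ^ 2 = κ p a

/-- Witness that `ρ(α)` — the real closure of `Frac (A / supp α)` with the ordering
induced by `α` — is `A / supp α`-isomorphic to the integral closure of (the image of)
`A / supp α` in `D`, where `h : A →+* D`.  The field `F` together with `j` is a copy of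
`ρ(α)`: a real closed field, algebraic over the image of `A`, whose ordering induces `α`
on `A`; `e` embeds it into `D` over `A` with image the integral closure. -/
structure RhoIsoIntegralClosure (A : Type u) [CommRing A] (α : PrimeCone A)
    (D : Type u) [CommRing D] (h : A →+* D) : Type (u + 1) where
  F : Type u
  [fieldF : Field F]
  j : A →+* F
  rcf : IsRealClosedField F
  ord : ∀ a : A, (∃ y : F, y ^ 2 = j a) ↔ a ∈ α.carrier
  alg : ∀ x : F, ∃ q : Polynomial A, Polynomial.eval₂ j x q = 0 ∧ q.map j ≠ 0
  e : F →+* D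
  comm : ∀ a : A, e (j a) = h a
  range_ic : Set.range e = {x : D | h.IsIntegralElem x}
namespace IsRealClosedField

open Polynomial IntermediateField

variable {R : Type u} [Field R]

theorem sq_add_sq_eq_zero {F : Type*} [CommRing F] (h : IsRealRing F) {x y : F}
    (hxy : x ^ 2 + y ^ 2 = 0) : x = 0 ∧ y = 0 := by
  have := h 2 ![x, y] (by simpa [Fin.sum_univ_two] using hxy)
  exact ⟨by simpa using this 0, by simpa using this 1⟩

theorem exists_sq_eq_add (hR : IsRealClosedField R) (a b : R) :
    ∃ c, c ^ 2 = a ^ 2 + b ^ 2 := by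
  rcases hR.2.1 (a ^ 2 + b ^ 2) with h | ⟨c, hc⟩
  · exact h
  · have := hR.1 3 ![a, b, c] (by simp [Fin.sum_univ_three, hc])
    have ha : a = 0 := by simpa using this 0
    have hb : b = 0 := by simpa using this 1
    exact ⟨0, by simp [ha, hb]⟩

/-- A real closed field is linearly ordered by its squares. -/
theorem exists_linearOrder (hR : IsRealClosedField R) :
    ∃ _ : LinearOrder R, IsStrictOrderedRing R := by
  classical
  have hanti : ∀ a b c d : R, c ^ 2 = b - a → d ^ 2 = a - b → a = b := by
    intro a b c d hc hd
    have := sq_add_sq_eq_zero hR.1 (x := c) (y := d) (by rw [hc, hd]; ring)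
    rw [this.1] at hc
    linear_combination hc
  let o : LinearOrder R :=
    { le := fun x y => ∃ z, z ^ 2 = y - x
      le_refl := fun x => ⟨0, by simp⟩
      le_trans := by
        rintro a b c ⟨x, hx⟩ ⟨y, hy⟩
        obtain ⟨z, hz⟩ := hR.exists_sq_eq_add x y
        exact ⟨z, by rw [hz, hx, hy]; ring⟩
      le_antisymm := by
        rintro a b ⟨x, hx⟩ ⟨y, hy⟩
        exact hanti a b x y hx hy
      le_total := by
        intro a b
        rcases hR.2.1 (b - a) with h | ⟨y, hy⟩
        · exact Or.inl h
        · exact Or.inr ⟨y, by rw [hy]; ring⟩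
      toDecidableLE := Classical.decRel _ }
  refine ⟨o, ?_⟩
  have : IsOrderedRing R :=
    { add_le_add_left := by
        rintro a b ⟨x, hx⟩ c
        exact ⟨x, by rw [hx]; ring⟩
      zero_le_one := ⟨1, by simp⟩
      mul_le_mul_of_nonneg_left := by
        rintro a ⟨x, hx⟩ b c ⟨y, hy⟩
        exact ⟨x * y, by rw [mul_pow, hx, hy]; ring⟩
      mul_le_mul_of_nonneg_right := by
        rintro a ⟨x, hx⟩ b c ⟨y, hy⟩
        exact ⟨x * y, by rw [mul_pow, hx, hy]; ring⟩ }
  exact IsOrderedRing.toIsStrictOrderedRing R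

theorem nonneg_iff [LinearOrder R] [IsStrictOrderedRing R] (hR : IsRealClosedField R) {x : R} :
    0 ≤ x ↔ ∃ y, y ^ 2 = x := by
  constructor
  · intro hx
    rcases hR.2.1 x with h | ⟨y, hy⟩
    · exact h
    · have : x = 0 := le_antisymm (by nlinarith [sq_nonneg y]) hx
      exact ⟨0, by simp [this]⟩
  · rintro ⟨y, rfl⟩
    exact sq_nonneg y

/-- If every element of `F` is a square, then `F` has no proper Galois extension of
degree a power of two. -/
theorem finrank_eq_one_of_forall_sq {F K : Type*} [Field F] [CharZero F] [Field K] [Algebra F K]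
    [FiniteDimensional F K] [IsGalois F K] (hsq : ∀ x : F, ∃ y, y ^ 2 = x) {m : ℕ}
    (hm : Module.finrank F K = 2 ^ m) : Module.finrank F K = 1 := by
  obtain _ | m := m
  · simpa using hm
  exfalso
  have hcard : Nat.card (K ≃ₐ[F] K) = 2 ^ (m + 1) := by
    rw [IsGalois.card_aut_eq_finrank, hm]
  have : Fact (Nat.Prime 2) := ⟨Nat.prime_two⟩
  obtain ⟨N, hN⟩ := Sylow.exists_subgroup_card_pow_prime (G := K ≃ₐ[F] K) 2 (n := m)
    (by rw [hcard]; exact pow_dvd_pow 2 (Nat.le_succ m))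
  have h1 := IntermediateField.finrank_fixedField_eq_card (F := F) (E := K) N
  have h2 := Module.finrank_mul_finrank F (fixedField N) K
  rw [h1, hN, hm, pow_succ, mul_comm] at h2
  have h3 : Module.finrank F (fixedField N) = 2 :=
    Nat.eq_of_mul_eq_mul_left (by positivity) h2
  obtain ⟨α, hα⟩ := Field.exists_primitive_element F (fixedField N)
  have hfi : IsIntegral F α := Algebra.IsIntegral.isIntegral α
  have hdeg : (minpoly F α).natDegree = 2 := by
    rw [← IntermediateField.adjoin.finrank hfi, hα, IntermediateField.finrank_top', h3]
  have hmon := minpoly.monic hfi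
  obtain ⟨s, hs⟩ := hsq (discrim 1 ((minpoly F α).coeff 1) ((minpoly F α).coeff 0))
  obtain ⟨x, hx⟩ := exists_quadratic_eq_zero (a := (1 : F)) one_ne_zero ⟨s, by rw [← hs, sq]⟩
  have hroot : (minpoly F α).IsRoot x := by
    have : (minpoly F α).coeff 2 = 1 := by rw [← hdeg]; exact hmon
    rw [IsRoot.def, eval_eq_sum_range, hdeg]
    simp [Finset.sum_range_succ, this]
    linear_combination hx
  have := natDegree_eq_of_degree_eq_some
    (degree_eq_one_of_irreducible_of_root (minpoly.irreducible hfi) hroot)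
  rw [hdeg] at this
  norm_num at this

theorem charZero (hR : IsRealClosedField R) : CharZero R := by
  obtain ⟨o, ho⟩ := hR.exists_linearOrder
  infer_instance

theorem exists_sq_of_sq_eq_neg_one (hR : IsRealClosedField R) {K : Type*} [Field K] [Algebra R K]
    {i : K} (hi : i ^ 2 = -1) (x y : R) :
    ∃ u v : R, (algebraMap R K u + algebraMap R K v * i) ^ 2 =
      algebraMap R K x + algebraMap R K y * i := by
  obtain ⟨o, ho⟩ := hR.exists_linearOrder
  obtain ⟨s₀, hs₀⟩ := hR.exists_sq_eq_add x y
  have hs : |s₀| ^ 2 = x ^ 2 + y ^ 2 := by rw [sq_abs, hs₀]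
  have hxs : |x| ≤ |s₀| := sq_le_sq.1 (by nlinarith [sq_nonneg y])
  have := abs_le.1 hxs
  set s := |s₀|
  obtain ⟨u, hu⟩ := hR.nonneg_iff.1 (show 0 ≤ (s + x) / 2 by linarith)
  obtain ⟨v, hv⟩ := hR.nonneg_iff.1 (show 0 ≤ (s - x) / 2 by linarith)
  have huv : (2 * u * v) ^ 2 = y ^ 2 := by
    rw [show (2 * u * v) ^ 2 = 4 * u ^ 2 * v ^ 2 by ring, hu, hv]
    linear_combination hs
  have key : ∀ w : R, w ^ 2 = v ^ 2 → 2 * u * w = y →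
      (algebraMap R K u + algebraMap R K w * i) ^ 2 =
        algebraMap R K x + algebraMap R K y * i := by
    intro w hw hwy
    have h1 : u ^ 2 - w ^ 2 = x := by rw [hw, hu, hv]; ring
    rw [← h1, ← hwy]
    simp only [map_sub, map_mul, map_pow, map_ofNat]
    linear_combination (algebraMap R K w) ^ 2 * hi
  rcases sq_eq_sq_iff_eq_or_eq_neg.1 huv with h | h
  · exact ⟨u, v, key v rfl h⟩
  · exact ⟨u, -v, key (-v) (by ring) (by linear_combination -h)⟩

theorem finrank_eq_one_of_odd (hR : IsRealClosedField R) {E : Type*} [Field E] [Algebra R E]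
    [FiniteDimensional R E] (hodd : Odd (Module.finrank R E)) : Module.finrank R E = 1 := by
  have := hR.charZero
  obtain ⟨α, hα⟩ := Field.exists_primitive_element R E
  have hfi : IsIntegral R α := Algebra.IsIntegral.isIntegral α
  have hdeg : (minpoly R α).natDegree = Module.finrank R E := by
    rw [← IntermediateField.adjoin.finrank hfi, hα, IntermediateField.finrank_top']
  obtain ⟨x, hx⟩ := hR.2.2 (minpoly R α) (hdeg ▸ hodd)
  rw [← hdeg]
  exact natDegree_eq_of_degree_eq_some
    (degree_eq_one_of_irreducible_of_root (minpoly.irreducible hfi) hx)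

theorem natDegree_le_two_of_irreducible (hR : IsRealClosedField R) {p : R[X]}
    (hp : Irreducible p) : p.natDegree ≤ 2 := by
  have := hR.charZero
  have hq0 : p * (X ^ 2 + 1) ≠ 0 := mul_ne_zero hp.ne_zero (by
    have : (X ^ 2 + C 1 : R[X]) ≠ 0 := X_pow_add_C_ne_zero (by norm_num) 1
    simpa using this)
  let K := (p * (X ^ 2 + 1)).SplittingField
  have : Normal R K := Normal.of_isSplittingField (p * (X ^ 2 + 1))
  have : IsGalois R K := {}
  have hsplit := SplittingField.splits (p * (X ^ 2 + 1))
  rw [Polynomial.map_mul] at hsplit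
  have hq0' : map (algebraMap R K) p * map (algebraMap R K) (X ^ 2 + 1) ≠ 0 := by
    rw [← Polynomial.map_mul]
    exact (Polynomial.map_ne_zero_iff (algebraMap R K).injective).2 hq0
  obtain ⟨z, hz⟩ := (hsplit.of_dvd hq0' (dvd_mul_right _ _)).exists_eval_eq_zero
    (by rw [degree_map]; exact (degree_pos_of_irreducible hp).ne')
  obtain ⟨i, hi⟩ := (hsplit.of_dvd hq0' (dvd_mul_left _ _)).exists_eval_eq_zero
    (by
      rw [degree_map, show (X ^ 2 + 1 : R[X]) = X ^ 2 + C 1 by simp,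
        degree_X_pow_add_C (by norm_num)]
      norm_num)
  replace hi : i ^ 2 = -1 := by
    simp at hi
    linear_combination hi
  -- the Galois group is a 2-group
  have : Fact (Nat.Prime 2) := ⟨Nat.prime_two⟩
  obtain ⟨H⟩ : Nonempty (Sylow 2 (K ≃ₐ[R] K)) := inferInstance
  have hHidx : Module.finrank R (fixedField (H : Subgroup (K ≃ₐ[R] K))) = H.index := by
    rw [IntermediateField.finrank_eq_fixingSubgroup_index,
      IntermediateField.fixingSubgroup_fixedField]
  have hone := hR.finrank_eq_one_of_odd
    (E := fixedField (H : Subgroup (K ≃ₐ[R] K))) (by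
      rw [hHidx]
      exact Nat.not_even_iff_odd.1 fun h => H.not_dvd_index h.two_dvd)
  have hcard : Module.finrank R K = Nat.card H := by
    rw [← Module.finrank_mul_finrank R (fixedField (H : Subgroup (K ≃ₐ[R] K))) K, hone, one_mul,
      IntermediateField.finrank_fixedField_eq_card]
  obtain ⟨n, hn⟩ := (IsPGroup.iff_card (p := 2)).1 H.isPGroup'
  rw [hn] at hcard
  -- the quadratic subfield
  have hiint : IsIntegral R i := Algebra.IsIntegral.isIntegral i
  have hmem : ∀ w ∈ R⟮i⟯, ∃ x y : R, w = algebraMap R K x + algebraMap R K y * i := by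
    intro w hw
    rw [← IntermediateField.mem_toSubalgebra,
      IntermediateField.adjoin_simple_toSubalgebra_of_isAlgebraic hiint.isAlgebraic] at hw
    induction hw using Algebra.adjoin_induction with
    | mem w hw =>
      rw [Set.mem_singleton_iff.1 hw]
      exact ⟨0, 1, by simp⟩
    | algebraMap r => exact ⟨r, 0, by rw [map_zero, zero_mul, add_zero]⟩
    | add a b _ _ ha hb =>
      obtain ⟨x, y, rfl⟩ := ha
      obtain ⟨x', y', rfl⟩ := hb
      exact ⟨x + x', y + y', by simp only [map_add]; ring⟩
    | mul a b _ _ ha hb =>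
      obtain ⟨x, y, rfl⟩ := ha
      obtain ⟨x', y', rfl⟩ := hb
      refine ⟨x * x' - y * y', x * y' + y * x', ?_⟩
      simp only [map_add, map_sub, map_mul]
      linear_combination (algebraMap R K y * algebraMap R K y') * hi
  have hsq : ∀ w : R⟮i⟯, ∃ t, t ^ 2 = w := by
    rintro ⟨w, hw⟩
    obtain ⟨x, y, rfl⟩ := hmem w hw
    obtain ⟨u, v, huv⟩ := hR.exists_sq_of_sq_eq_neg_one hi x y
    refine ⟨⟨algebraMap R K u + algebraMap R K v * i, ?_⟩, Subtype.ext huv⟩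
    exact add_mem (IntermediateField.algebraMap_mem _ _)
      (mul_mem (IntermediateField.algebraMap_mem _ _) (mem_adjoin_simple_self R i))
  have hmul := Module.finrank_mul_finrank R R⟮i⟯ K
  rw [hcard] at hmul
  obtain ⟨m, -, hm⟩ := (Nat.dvd_prime_pow Nat.prime_two).1 (Dvd.intro_left _ hmul)
  have h1 := finrank_eq_one_of_forall_sq hsq hm
  have hzint : IsIntegral R z := Algebra.IsIntegral.isIntegral z
  have hz' : Polynomial.aeval z p = 0 := by rwa [eval_map_algebraMap] at hz
  have hzmem : z ∈ R⟮i⟯ := by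
    rw [IntermediateField.finrank_eq_one_iff_eq_top.1 h1]
    exact IntermediateField.mem_top
  obtain ⟨x, y, hxy⟩ := hmem z hzmem
  have hQ : Polynomial.aeval z ((X - C x) ^ 2 + C (y ^ 2)) = 0 := by
    rw [hxy]
    simp only [map_add, map_pow, map_sub, aeval_X, aeval_C]
    linear_combination (algebraMap R K y) ^ 2 * hi
  have hQdeg : ((X - C x) ^ 2 + C (y ^ 2)).natDegree = 2 := by
    rw [natDegree_add_C, natDegree_pow, natDegree_X_sub_C]
  have hdvd : p ∣ (X - C x) ^ 2 + C (y ^ 2) := by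
    by_contra hnd
    obtain ⟨a, b, hab⟩ := (hp.coprime_iff_not_dvd).2 hnd
    have := congrArg (Polynomial.aeval z) hab
    rw [map_add, map_mul, map_mul, hz', hQ] at this
    simp at this
  rw [← hQdeg]
  exact natDegree_le_of_dvd hdvd (by
    intro h0
    rw [h0] at hQdeg
    simp at hQdeg)

end IsRealClosedField

namespace IsRealClosedField

open Polynomial

section Ordered

variable {R : Type u} [Field R] [LinearOrder R] [IsStrictOrderedRing R]

theorem eval_mul_eval_pos_of_irreducible (hR : IsRealClosedField R) {p : R[X]}
    (hp : Irreducible p) {a b : R} (hab : a ≤ b)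
    (h : ∀ c, a ≤ c → c ≤ b → p.eval c ≠ 0) : 0 < p.eval a * p.eval b := by
  have h2 := hR.natDegree_le_two_of_irreducible hp
  have h0 := hp.natDegree_pos
  obtain h1 | h2 : p.natDegree = 1 ∨ p.natDegree = 2 := by omega
  · obtain ⟨u, v, rfl⟩ := exists_eq_X_add_C_of_natDegree_le_one h1.le
    have hu : u ≠ 0 := by
      rintro rfl
      simp at h1
    simp only [eval_add, eval_mul, eval_C, eval_X] at h ⊢
    have hroot : u * (-v / u) + v = 0 := by field_simp; ring
    have hcase : -v / u < a ∨ b < -v / u := by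
      by_contra! hc
      exact h _ hc.1 hc.2 hroot
    have hu2 : 0 < u ^ 2 := by positivity
    have hv : v = -(u * (-v / u)) := by linear_combination hroot
    generalize -v / u = r at hv hcase
    subst hv
    have : 0 < (a - r) * (b - r) := by
      rcases hcase with hc | hc
      · exact mul_pos (by linarith) (by linarith)
      · exact mul_pos_of_neg_of_neg (by linarith) (by linarith)
    calc 0 < u ^ 2 * ((a - r) * (b - r)) := mul_pos hu2 this
      _ = _ := by ring
  · have hnoroot : ∀ c, p.eval c ≠ 0 := by
      intro c hc
      have : p.natDegree = 1 :=
        natDegree_eq_of_degree_eq_some (degree_eq_one_of_irreducible_of_root hp hc)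
      omega
    have hpe : ∀ c, p.eval c = p.coeff 2 * (c * c) + p.coeff 1 * c + p.coeff 0 := by
      intro c
      rw [eval_eq_sum_range, h2]
      simp [Finset.sum_range_succ]
      ring
    have hu : p.coeff 2 ≠ 0 := by
      rw [← h2]
      exact leadingCoeff_ne_zero.2 hp.ne_zero
    have hdisc : discrim (p.coeff 2) (p.coeff 1) (p.coeff 0) < 0 := by
      by_contra! hd
      obtain ⟨s, hs⟩ := hR.nonneg_iff.1 hd
      obtain ⟨x, hx⟩ := exists_quadratic_eq_zero hu ⟨s, by rw [← hs, sq]⟩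
      exact hnoroot x (by rw [hpe, hx])
    have hpos : ∀ c, 0 < p.coeff 2 * p.eval c := by
      intro c
      rw [hpe]
      unfold discrim at hdisc
      nlinarith [sq_nonneg (2 * p.coeff 2 * c + p.coeff 1)]
    have := mul_pos (hpos a) (hpos b)
    have hu2 : 0 < p.coeff 2 ^ 2 := by positivity
    exact pos_of_mul_pos_right (a := p.coeff 2 ^ 2) (by linarith) hu2.le

/-- A polynomial without roots in an interval does not change sign there. -/
theorem eval_mul_eval_pos (hR : IsRealClosedField R) (p : R[X]) {a b : R} (hab : a ≤ b)
    (h : ∀ c, a ≤ c → c ≤ b → p.eval c ≠ 0) : 0 < p.eval a * p.eval b := by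
  induction p using WfDvdMonoid.induction_on_irreducible with
  | zero => exact absurd eval_zero (h a le_rfl hab)
  | unit u hu =>
    obtain ⟨c, hc, rfl⟩ := isUnit_iff.1 hu
    have : c ≠ 0 := hc.ne_zero
    simp only [eval_C]
    exact mul_self_pos.2 this
  | mul q i hq hi ih =>
    have h1 := ih fun c hac hcb h0 => h c hac hcb (by rw [eval_mul, h0, mul_zero])
    have h2 := hR.eval_mul_eval_pos_of_irreducible hi hab
      fun c hac hcb h0 => h c hac hcb (by rw [eval_mul, h0, zero_mul])
    rw [eval_mul, eval_mul]
    calc 0 < _ := mul_pos h1 h2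
      _ = _ := by ring

theorem exists_root_of_mul_neg (hR : IsRealClosedField R) (p : R[X]) {a b : R} (hab : a ≤ b)
    (h : p.eval a * p.eval b < 0) : ∃ c, a < c ∧ c < b ∧ p.eval c = 0 := by
  by_contra! hc
  refine absurd (hR.eval_mul_eval_pos p hab fun c hac hcb h0 => ?_) h.not_gt
  rcases hac.eq_or_lt with rfl | hac
  · simp [h0] at h
  rcases hcb.eq_or_lt with rfl | hcb
  · simp [h0] at h
  exact hc c hac hcb h0

/-- Rolle's theorem for consecutive simple roots. -/
theorem exists_derivative_root (hR : IsRealClosedField R) (p : R[X]) {x y : R} (hxy : x < y)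
    (hx : p.eval x = 0) (hy : p.eval y = 0) (hx' : p.derivative.eval x ≠ 0)
    (hy' : p.derivative.eval y ≠ 0) (h : ∀ c, x < c → c < y → p.eval c ≠ 0) :
    ∃ c, x < c ∧ c < y ∧ p.derivative.eval c = 0 := by
  obtain ⟨q, rfl⟩ := dvd_iff_isRoot.2 hx
  have hq : q.eval y = 0 := by
    simpa [sub_ne_zero.2 hxy.ne'] using hy
  obtain ⟨g, rfl⟩ := dvd_iff_isRoot.2 hq
  simp at hx' hy'
  refine hR.exists_root_of_mul_neg _ hxy.le ?_
  have hg := hR.eval_mul_eval_pos g hxy.le (by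
    intro c hac hcb h0
    rcases hac.eq_or_lt with rfl | hac
    · exact hx'.2 h0
    rcases hcb.eq_or_lt with rfl | hcb
    · exact hy'.2 h0
    exact h c hac hcb (by simp [h0]))
  have : 0 < (y - x) ^ 2 := pow_pos (sub_pos.2 hxy) 2
  simp
  nlinarith [mul_pos this hg]

/-- A separable polynomial changes sign on an interval which contains a root and on which it
is monotone. -/
theorem eval_mul_eval_neg (hR : IsRealClosedField R) (p : R[X]) {d a d' : R} (hda : d < a)
    (had' : a < d') (ha : p.eval a = 0) (hd : p.eval d ≠ 0) (hd' : p.eval d' ≠ 0)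
    (h : ∀ c, d < c → c < d' → p.derivative.eval c ≠ 0) : p.eval d * p.eval d' < 0 := by
  have hp0 : p ≠ 0 := by
    rintro rfl
    simp at hd
  -- two distinct roots would produce a root of the derivative
  have huniq : ∀ x y, d < x → x < y → y < d' → p.eval x = 0 → p.eval y = 0 → False := by
    intro x y hdx hxy hyd' hx hy
    obtain ⟨z, hz, hzmin⟩ := Finset.exists_min_image
      (p.roots.toFinset.filter fun t => x < t) id
      ⟨y, by simp [hp0, hy, hxy]⟩
    simp [hp0] at hz hzmin
    have hzy : z ≤ y := hzmin y hy hxy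
    obtain ⟨c, hxc, hcz, hc⟩ := hR.exists_derivative_root p hz.2 hx hz.1
      (h x hdx (by linarith)) (h z (by linarith [hz.2]) (by linarith))
      (fun c hxc hcz h0 => absurd (hzmin c h0 hxc) hcz.not_ge)
    exact h c (by linarith) (by linarith) hc
  have ha' := h a hda had'
  obtain ⟨g, rfl⟩ := dvd_iff_isRoot.2 ha
  simp at ha' hd hd'
  have hg := hR.eval_mul_eval_pos g (hda.trans had').le (by
    intro c hac hcb h0
    rcases hac.eq_or_lt with rfl | hac
    · exact hd.2 h0
    rcases hcb.eq_or_lt with rfl | hcb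
    · exact hd'.2 h0
    rcases lt_trichotomy c a with hca | rfl | hca
    · exact huniq c a hac hca had' (by simp [h0]) ha
    · exact ha' h0
    · exact huniq a c hda hca hcb ha (by simp [h0]))
  have : (d - a) * (d' - a) < 0 := mul_neg_of_neg_of_pos (by linarith) (by linarith)
  simp
  calc _ = ((d - a) * (d' - a)) * (g.eval d * g.eval d') := by ring
    _ < 0 := mul_neg_of_neg_of_pos this hg

end Ordered

/-- A real closed field has no proper real algebraic extension. -/
theorem surjective_of_isIntegral {R E : Type*} [Field R] [Field E] (hR : IsRealClosedField R)
    (hE : IsRealRing E) (φ : R →+* E) (hφ : φ.IsIntegral) : Function.Surjective φ := by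
  algebraize [φ]
  intro x
  have hfi : IsIntegral R x := hφ x
  obtain ⟨o, ho⟩ := hR.exists_linearOrder
  have hirr := minpoly.irreducible hfi
  have hle := hR.natDegree_le_two_of_irreducible hirr
  have hpos := hirr.natDegree_pos
  obtain h1 | h2 : (minpoly R x).natDegree = 1 ∨ (minpoly R x).natDegree = 2 := by omega
  · exact minpoly.mem_range_of_degree_eq_one R x
      ((degree_eq_iff_natDegree_eq_of_pos one_pos).2 h1)
  · exfalso
    have hmon : (minpoly R x).coeff 2 = 1 := by
      rw [← h2]
      exact minpoly.monic hfi
    have hx := minpoly.aeval R x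
    rw [aeval_eq_sum_range, h2] at hx
    simp only [Finset.sum_range_succ, Finset.sum_range_zero, hmon, Algebra.smul_def, map_one,
      pow_zero, pow_one, mul_one, one_mul, zero_add] at hx
    set b := (minpoly R x).coeff 1
    set c := (minpoly R x).coeff 0
    have hdisc : b ^ 2 - 4 * c < 0 := by
      by_contra! hd
      obtain ⟨s, hs⟩ := hR.nonneg_iff.1 hd
      have hroot : (minpoly R x).IsRoot ((s - b) / 2) := by
        rw [IsRoot.def, eval_eq_sum_range, h2]
        simp only [Finset.sum_range_succ, Finset.sum_range_zero, hmon]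
        change 0 + c * _ + b * _ + _ = 0
        field_simp
        linear_combination hs
      have : (minpoly R x).natDegree = 1 := natDegree_eq_of_degree_eq_some
        (degree_eq_one_of_irreducible_of_root hirr hroot)
      omega
    obtain ⟨s, hs⟩ := hR.nonneg_iff.1 (show 0 ≤ 4 * c - b ^ 2 by linarith)
    have hzero := sq_add_sq_eq_zero hE (x := 2 * x + algebraMap R E b) (y := algebraMap R E s) (by
      rw [← map_pow, hs, map_sub, map_mul, map_pow, map_ofNat]
      linear_combination 4 * hx)
    have hs0 : s = 0 := (map_eq_zero _).1 hzero.2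
    rw [hs0] at hs
    simp at hs
    linarith

end IsRealClosedField

namespace IsRealClosedField

open Polynomial

theorem exists_bound_of_root {L R : Type*} [Field L] [Field R] [LinearOrder R]
    [IsStrictOrderedRing R] (i : L →+* R) {f : L[X]} (hf : f.Monic) {a : R}
    (ha : f.eval₂ i a = 0) : ∃ t : L, i (-t) < a ∧ a < i t := by
  set n := f.natDegree with hn
  set t : L := 1 + ∑ k ∈ Finset.range n, (1 + f.coeff k ^ 2) with ht
  have hit : i t = 1 + ∑ k ∈ Finset.range n, (1 + i (f.coeff k) ^ 2) := by simp [ht]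
  have hcoeff : ∀ x : R, |x| ≤ 1 + x ^ 2 := fun x => by
    rcases abs_cases x with h | h <;> nlinarith [sq_nonneg (x - 1), sq_nonneg (x + 1)]
  suffices h : |a| < i t by
    rw [abs_lt] at h
    exact ⟨t, by rw [map_neg]; exact h.1, h.2⟩
  by_contra! h
  have hsum : 0 ≤ ∑ k ∈ Finset.range n, (1 + i (f.coeff k) ^ 2) :=
    Finset.sum_nonneg fun k _ => by positivity
  have h1 : 1 ≤ |a| := by linarith
  have ha' : a ^ n = -∑ k ∈ Finset.range n, i (f.coeff k) * a ^ k := by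
    rw [eval₂_eq_sum_range, Finset.sum_range_succ, ← hn, hf.coeff_natDegree, map_one, one_mul] at ha
    linear_combination ha
  have hle : |a| * |a| ^ n ≤ (i t - 1) * |a| ^ n := by
    calc |a| * |a| ^ n = |a| * |a ^ n| := by rw [abs_pow]
      _ = |a| * |∑ k ∈ Finset.range n, i (f.coeff k) * a ^ k| := by rw [ha', abs_neg]
      _ ≤ |a| * ∑ k ∈ Finset.range n, |i (f.coeff k) * a ^ k| := by
        gcongr
        exact Finset.abs_sum_le_sum_abs _ _
      _ = ∑ k ∈ Finset.range n, |i (f.coeff k)| * |a| ^ (k + 1) := by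
        rw [Finset.mul_sum]
        refine Finset.sum_congr rfl fun k _ => ?_
        rw [abs_mul, abs_pow]
        ring
      _ ≤ ∑ k ∈ Finset.range n, (1 + i (f.coeff k) ^ 2) * |a| ^ n := by
        refine Finset.sum_le_sum fun k hk => ?_
        have := Finset.mem_range.1 hk
        exact mul_le_mul (hcoeff _) (pow_le_pow_right₀ h1 this) (by positivity) (by positivity)
      _ = (i t - 1) * |a| ^ n := by rw [← Finset.sum_mul, hit]; ring
  have hpos : 0 < |a| ^ n := by positivity
  have := le_of_mul_le_mul_right hle hpos
  linarith

theorem nonneg_eval_iff_of_no_root {R : Type*} [Field R] [LinearOrder R] [IsStrictOrderedRing R]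
    (hR : IsRealClosedField R) (p : R[X]) {u v x y : R} (hux : u < x) (hxv : x < v)
    (huy : u < y) (hyv : y < v) (h : ∀ c, u < c → c < v → p.eval c ≠ 0) :
    0 ≤ p.eval x ↔ 0 ≤ p.eval y := by
  have hpos : 0 < p.eval x * p.eval y := by
    rcases le_total x y with hxy | hxy
    · exact hR.eval_mul_eval_pos p hxy fun c hc hc' => h c (hux.trans_le hc) (hc'.trans_lt hyv)
    · rw [mul_comm]
      exact hR.eval_mul_eval_pos p hxy fun c hc hc' => h c (huy.trans_le hc) (hc'.trans_lt hxv)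
  rcases pos_and_pos_or_neg_and_neg_of_mul_pos hpos with h | h
  · exact ⟨fun _ => h.2.le, fun _ => h.1.le⟩
  · exact ⟨fun h' => absurd h' h.1.not_ge, fun h' => absurd h' h.2.not_ge⟩

/-- The extension step in the uniqueness of real closures: a root of minimal degree in one real
closed field can be matched with a root in the other one, respecting the orderings. -/
theorem exists_root_with_same_signs {L R₁ R₂ : Type*} [Field L]
    [Field R₁] [LinearOrder R₁] [IsStrictOrderedRing R₁]
    [Field R₂] [LinearOrder R₂] [IsStrictOrderedRing R₂]
    (h₁ : IsRealClosedField R₁) (h₂ : IsRealClosedField R₂) (i₁ : L →+* R₁) (i₂ : L →+* R₂)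
    (hord : ∀ x, 0 ≤ i₁ x ↔ 0 ≤ i₂ x) {n : ℕ} (hn : 2 ≤ n)
    (hroot₁ : ∀ g : L[X], g ≠ 0 → g.natDegree < n → ∀ c, g.eval₂ i₁ c = 0 → ∃ s, i₁ s = c)
    (hroot₂ : ∀ g : L[X], g ≠ 0 → g.natDegree < n → ∀ c, g.eval₂ i₂ c = 0 → ∃ s, i₂ s = c)
    {f : L[X]} (hf : Irreducible f) (hmon : f.Monic) (hdeg : f.natDegree = n) {a : R₁}
    (ha : f.eval₂ i₁ a = 0) (hna : ∀ s, i₁ s ≠ a) :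
    ∃ b, f.eval₂ i₂ b = 0 ∧ ∀ r : L[X], 0 ≤ r.eval₂ i₁ a ↔ 0 ≤ r.eval₂ i₂ b := by
  classical
  have : CharZero L := RingHom.charZero i₁
  have hlt : ∀ x y, i₁ x < i₁ y ↔ i₂ x < i₂ y := fun x y => by
    have := hord (x - y)
    rw [map_sub, map_sub, sub_nonneg, sub_nonneg] at this
    rw [← not_le, ← not_le, this]
  have hnoroot : ∀ s, f.eval s ≠ 0 := fun s hs => by
    have : f.natDegree = 1 :=
      natDegree_eq_of_degree_eq_some (degree_eq_one_of_irreducible_of_root hf hs)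
    omega
  by_contra hcon
  have hbad : ∀ b, f.eval₂ i₂ b = 0 → ∃ r : L[X], r ≠ 0 ∧ r.natDegree < n ∧
      ¬(0 ≤ r.eval₂ i₁ a ↔ 0 ≤ r.eval₂ i₂ b) := by
    intro b hb
    by_contra hno
    refine hcon ⟨b, hb, fun r => ?_⟩
    have hmod := EuclideanDomain.div_add_mod r f
    rw [← hmod]
    simp only [eval₂_add, eval₂_mul, ha, hb, zero_mul, zero_add]
    by_cases hr0 : r % f = 0
    · simp [hr0]
    by_contra hno'
    refine hno ⟨r % f, hr0, ?_, hno'⟩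
    rw [← hdeg]
    exact natDegree_lt_natDegree hr0 (EuclideanDomain.mod_lt r hf.ne_zero)
  choose! r hr0 hrn hr using hbad
  set B := (f.map i₂).roots.toFinset
  have hB : ∀ b, b ∈ B ↔ f.eval₂ i₂ b = 0 := fun b => by
    have : f.map i₂ ≠ 0 := (Polynomial.map_ne_zero_iff i₂.injective).2 hf.ne_zero
    simp [B, this, eval_map, IsRoot.def]
  set G := derivative f * ∏ b ∈ B, r b with hGdef
  have hf'0 : derivative f ≠ 0 := fun h => by
    have := derivative_eq_zero.1 h
    omega
  have hG : G ≠ 0 :=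
    mul_ne_zero hf'0 (Finset.prod_ne_zero_iff.2 fun b hb => hr0 b ((hB b).1 hb))
  obtain ⟨t, hta, hat⟩ := exists_bound_of_root i₁ hmon ha
  set D : Finset L := G.roots.toFinset ∪ {t, -t}
  obtain ⟨d, hd, hdmax⟩ := Finset.exists_max_image (D.filter fun s => i₁ s < a) i₁
    ⟨-t, by simp only [Finset.mem_filter]; exact ⟨by simp [D], hta⟩⟩
  obtain ⟨d', hd', hdmin⟩ := Finset.exists_min_image (D.filter fun s => a < i₁ s) i₁
    ⟨t, by simp only [Finset.mem_filter]; exact ⟨by simp [D], hat⟩⟩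
  have hda := (Finset.mem_filter.1 hd).2
  have had' := (Finset.mem_filter.1 hd').2
  have hno : ∀ g, g ∣ G → ∀ s, i₁ d < i₁ s → i₁ s < i₁ d' → g.eval s ≠ 0 := by
    intro g hg s hds hsd' h0
    have hsD : s ∈ D := by
      refine Finset.mem_union_left _ ?_
      rw [Multiset.mem_toFinset, mem_roots hG]
      exact (show g.IsRoot s from h0).dvd hg
    rcases lt_or_gt_of_ne (hna s) with h | h
    · exact absurd (hdmax s (Finset.mem_filter.2 ⟨hsD, h⟩)) hds.not_ge
    · exact absurd (hdmin s (Finset.mem_filter.2 ⟨hsD, h⟩)) hsd'.not_ge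
  have hno₁ : ∀ g, g ∣ G → g ≠ 0 → g.natDegree < n →
      ∀ c, i₁ d < c → c < i₁ d' → (g.map i₁).eval c ≠ 0 := by
    intro g hg hg0 hgn c hdc hcd' h0
    rw [eval_map] at h0
    obtain ⟨s, rfl⟩ := hroot₁ g hg0 hgn c h0
    rw [eval₂_at_apply, map_eq_zero] at h0
    exact hno g hg s hdc hcd' h0
  have hno₂ : ∀ g, g ∣ G → g ≠ 0 → g.natDegree < n →
      ∀ c, i₂ d < c → c < i₂ d' → (g.map i₂).eval c ≠ 0 := by
    intro g hg hg0 hgn c hdc hcd' h0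
    rw [eval_map] at h0
    obtain ⟨s, rfl⟩ := hroot₂ g hg0 hgn c h0
    rw [eval₂_at_apply, map_eq_zero] at h0
    exact hno g hg s ((hlt _ _).2 hdc) ((hlt _ _).2 hcd') h0
  have hev₁ : ∀ s, (f.map i₁).eval (i₁ s) = i₁ (f.eval s) := fun s => by
    rw [eval_map, eval₂_at_apply]
  have hev₂ : ∀ s, (f.map i₂).eval (i₂ s) = i₂ (f.eval s) := fun s => by
    rw [eval_map, eval₂_at_apply]
  have hneg := h₁.eval_mul_eval_neg (f.map i₁) hda had' (by rwa [eval_map])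
    (by rw [hev₁]; exact (map_ne_zero i₁).2 (hnoroot d))
    (by rw [hev₁]; exact (map_ne_zero i₁).2 (hnoroot d'))
    (by
      rw [derivative_map]
      exact hno₁ _ (dvd_mul_right _ _) hf'0 (hdeg ▸ natDegree_derivative_lt (by omega)))
  have hdd₂ : i₂ d < i₂ d' := (hlt _ _).1 (hda.trans had')
  obtain ⟨b, hdb, hbd', hb⟩ := h₂.exists_root_of_mul_neg (f.map i₂) hdd₂.le (by
    rw [hev₂, hev₂, ← map_mul, ← map_zero i₂, ← hlt, map_zero, map_mul, ← hev₁, ← hev₁]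
    exact hneg)
  rw [eval_map] at hb
  have hdvd : r b ∣ G :=
    (Finset.dvd_prod_of_mem r ((hB b).2 hb)).trans (dvd_mul_left _ _)
  have hm₁ : i₁ d < i₁ ((d + d') / 2) ∧ i₁ ((d + d') / 2) < i₁ d' := by
    rw [map_div₀, map_add, map_ofNat]
    constructor <;> linarith
  have e₁ := h₁.nonneg_eval_iff_of_no_root ((r b).map i₁) hda had' hm₁.1 hm₁.2
    (hno₁ _ hdvd (hr0 b hb) (hrn b hb))
  have e₂ := h₂.nonneg_eval_iff_of_no_root ((r b).map i₂) hdb hbd' ((hlt _ _).1 hm₁.1)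
    ((hlt _ _).1 hm₁.2) (hno₂ _ hdvd (hr0 b hb) (hrn b hb))
  rw [eval_map, eval_map, eval₂_at_apply] at e₁ e₂
  exact hr b hb (e₁.trans ((hord _).trans e₂.symm))

end IsRealClosedField

namespace IsVonNeumannRegular

open Polynomial

variable {R : Type*} [CommRing R]

theorem exists_mul_isIdempotentElem (hR : IsVonNeumannRegular R) (a : R) :
    ∃ b, IsIdempotentElem (a * b) ∧ a * b * a = a := by
  obtain ⟨b, hb⟩ := hR a
  refine ⟨b, ?_, by linear_combination -hb⟩
  rw [IsIdempotentElem]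
  linear_combination -b * hb

theorem isReduced (hR : IsVonNeumannRegular R) : IsReduced R :=
  isReduced_iff_pow_one_lt 2 one_lt_two |>.2 fun x hx => by
    obtain ⟨b, hb⟩ := hR x
    rw [hb, hx, zero_mul]

theorem exists_isIdempotentElem_notMem (hR : IsVonNeumannRegular R) {q : Ideal R} (hq : q ≠ ⊤)
    {x : R} (hx : x ∈ q) : ∃ e, IsIdempotentElem e ∧ e ∉ q ∧ e * x = 0 := by
  obtain ⟨b, hb, hx'⟩ := hR.exists_mul_isIdempotentElem x
  refine ⟨1 - x * b, hb.one_sub, fun h => hq ?_, by linear_combination -hx'⟩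
  rw [Ideal.eq_top_iff_one]
  simpa using q.add_mem h (q.mul_mem_right b hx)

theorem isMaximal (hR : IsVonNeumannRegular R) (q : Ideal R) [hq : q.IsPrime] : q.IsMaximal := by
  refine Ideal.isMaximal_iff.2 ⟨(Ideal.ne_top_iff_one q).1 hq.ne_top, fun J x hqJ hxq hxJ => ?_⟩
  obtain ⟨b, -, hb⟩ := hR.exists_mul_isIdempotentElem x
  have h : (1 - x * b) * x ∈ q := by
    rw [show (1 - x * b) * x = 0 by linear_combination -hb]
    exact q.zero_mem
  have h' := (hq.mem_or_mem h).resolve_right hxq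
  simpa using J.add_mem (hqJ h') (J.mul_mem_right b hxJ)

theorem quotient (hR : IsVonNeumannRegular R) (I : Ideal R) : IsVonNeumannRegular (R ⧸ I) := by
  intro x
  obtain ⟨x, rfl⟩ := Ideal.Quotient.mk_surjective x
  obtain ⟨y, hy⟩ := hR x
  exact ⟨Ideal.Quotient.mk I y, by rw [← map_pow, ← map_mul, ← hy]⟩

theorem of_isField (hR : IsField R) : IsVonNeumannRegular R := by
  intro x
  by_cases hx : x = 0
  · exact ⟨0, by simp [hx]⟩
  · obtain ⟨y, hy⟩ := hR.mul_inv_cancel hx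
    exact ⟨y, by linear_combination -x * hy⟩

theorem pi {ι : Type*} {K : ι → Type*} [∀ i, CommRing (K i)]
    (hK : ∀ i, IsVonNeumannRegular (K i)) : IsVonNeumannRegular (∀ i, K i) := by
  intro x
  choose y hy using fun i => hK i (x i)
  exact ⟨y, funext hy⟩

theorem of_isIntegral {C : Type*} [CommRing C] [IsReduced C] (hR : IsVonNeumannRegular R)
    {f : R →+* C} (hf : f.IsIntegral) : IsVonNeumannRegular C := by
  suffices h : ∀ n (p : R[X]), p.Monic → p.natDegree = n → ∀ g y : C, IsIdempotentElem g →
      g * y * p.eval₂ f y = 0 → ∃ z, g * y = g * y ^ 2 * z by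
    intro y
    obtain ⟨p, hp, hpy⟩ := hf y
    obtain ⟨z, hz⟩ := h _ p hp rfl 1 y .one (by simp [hpy])
    exact ⟨z, by simpa using hz⟩
  intro n
  induction n with
  | zero =>
    intro p hp hp0 g y _ hy
    rw [hp.natDegree_eq_zero.1 hp0] at hy
    exact ⟨0, by simpa using hy⟩
  | succ n ih =>
    intro p hp hpn g y hg hy
    obtain ⟨b, hb, hcb⟩ := hR.exists_mul_isIdempotentElem (p.coeff 0)
    have hq : p.divX.natDegree = n := by rw [natDegree_divX_eq_natDegree_tsub_one, hpn]; rfl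
    have hqm : p.divX.Monic := by
      rw [Monic, leadingCoeff, hq, coeff_divX, ← hpn]
      exact hp
    have hpy : p.eval₂ f y = y * p.divX.eval₂ f y + f (p.coeff 0) := by
      conv_lhs => rw [← X_mul_divX_add p]
      simp only [eval₂_add, eval₂_mul, eval₂_X, eval₂_C]
    set q := p.divX.eval₂ f y
    rw [hpy] at hy
    have hb' := congrArg f hb
    have hcb' := congrArg f hcb
    simp only [map_mul] at hb' hcb'
    set c := f (p.coeff 0)
    have hsq : (g * (1 - c * f b) * y * q) ^ 2 = 0 := by
      linear_combination (g * (1 - c * f b) ^ 2 * q) * hy + (g ^ 2 * y * (1 - c * f b) * q) * hcb'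
    obtain ⟨z, hz⟩ := ih p.divX hqm hq (g * (1 - c * f b)) y
      (hg.mul (IsIdempotentElem.one_sub hb')) (by simpa using pow_eq_zero_iff two_ne_zero |>.1 hsq)
    refine ⟨c * f b * (-f b * q) + (1 - c * f b) * z, ?_⟩
    linear_combination hz + c * f b * f b * hy - g * y * hb'

end IsVonNeumannRegular

theorem IsRealRing.quotient {R : Type*} [CommRing R] (hreal : IsRealRing R)
    (hR : IsVonNeumannRegular R) (I : Ideal R) : IsRealRing (R ⧸ I) := by
  intro n f hf i
  choose r hr using fun i => Ideal.Quotient.mk_surjective (f i)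
  obtain rfl : (fun i => Ideal.Quotient.mk I (r i)) = f := funext hr
  have hmem : ∑ i, r i ^ 2 ∈ I := by
    rw [← Ideal.Quotient.eq_zero_iff_mem, map_sum]
    simpa using hf
  set a := ∑ i, r i ^ 2 with ha
  obtain ⟨b, hb, hab⟩ := hR.exists_mul_isIdempotentElem a
  have h0 := hreal n (fun i => (1 - a * b) * r i) (by
    simp only [mul_pow, ← Finset.mul_sum, ← ha]
    linear_combination -(1 - a * b) * hab) i
  refine Ideal.Quotient.eq_zero_iff_mem.2 ?_
  rw [show r i = a * (b * r i) by linear_combination h0]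
  exact I.mul_mem_right _ hmem

theorem IsRealRing.isReduced {R : Type*} [CommRing R] (hreal : IsRealRing R) : IsReduced R :=
  isReduced_iff_pow_one_lt 2 one_lt_two |>.2 fun x hx =>
    hreal 1 (fun _ => x) (by simpa using hx) 0

theorem IsRealRing.pi {ι : Type*} {K : ι → Type*} [∀ i, CommRing (K i)]
    (hK : ∀ i, IsRealRing (K i)) : IsRealRing (∀ i, K i) := by
  intro n f hf j
  funext i
  exact hK i n (fun j => f j i) (by simpa using congrFun hf i) j

theorem IsRealRing.of_injective {R S : Type*} [CommRing R] [CommRing S] (hS : IsRealRing S)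
    {f : R →+* S} (hf : Function.Injective f) : IsRealRing R := by
  intro n g hg j
  apply hf
  rw [map_zero]
  exact hS n (fun j => f (g j)) (by simpa using congrArg f hg) j

theorem exists_isEssentialExtension_quotient {A B : Type*} [CommRing A] [CommRing B]
    {φ : A →+* B} (hφ : Function.Injective φ) :
    ∃ I : Ideal B, IsEssentialExtension ((Ideal.Quotient.mk I).comp φ) := by
  obtain ⟨I, hI⟩ := zorn_le_nonempty₀ {I : Ideal B | ∀ a, φ a ∈ I → a = 0} (by
    intro c hc hchain y hy
    refine ⟨sSup c, fun a ha => ?_, fun z hz => le_sSup hz⟩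
    obtain ⟨J, hJ, haJ⟩ := (Submodule.mem_sSup_of_directed ⟨y, hy⟩ hchain.directedOn).1 ha
    exact hc hJ a haJ) ⊥ (fun a ha => hφ (by simpa using ha))
  obtain ⟨-, hI⟩ := hI
  refine ⟨I, (injective_iff_map_eq_zero _).2 fun a ha =>
    hI.prop a (Ideal.Quotient.eq_zero_iff_mem.1 ha), fun J hJ => ?_⟩
  by_contra! hcon
  refine hJ (le_bot_iff.1 ?_)
  have hle : I ≤ J.comap (Ideal.Quotient.mk I) := fun x hx => by
    rw [Ideal.mem_comap, Ideal.Quotient.eq_zero_iff_mem.2 hx]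
    exact J.zero_mem
  have := hI.le_of_ge (y := J.comap (Ideal.Quotient.mk I)) (fun a ha =>
    hI.prop a (Ideal.Quotient.eq_zero_iff_mem.1 (hcon a ha))) hle
  intro x hx
  obtain ⟨x, rfl⟩ := Ideal.Quotient.mk_surjective x
  exact Ideal.Quotient.eq_zero_iff_mem.2 (this hx)

namespace IsRealClosedField

open Polynomial

theorem exists_pair_with_same_signs {L R₁ R₂ : Type*} [Field L]
    [Field R₁] [LinearOrder R₁] [IsStrictOrderedRing R₁]
    [Field R₂] [LinearOrder R₂] [IsStrictOrderedRing R₂]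
    (h₁ : IsRealClosedField R₁) (h₂ : IsRealClosedField R₂) (i₁ : L →+* R₁) (i₂ : L →+* R₂)
    (hord : ∀ x, 0 ≤ i₁ x ↔ 0 ≤ i₂ x) {n : ℕ}
    (hroot₁ : ∀ g : L[X], g ≠ 0 → g.natDegree < n → ∀ c, g.eval₂ i₁ c = 0 → ∃ s, i₁ s = c)
    (hroot₂ : ∀ g : L[X], g ≠ 0 → g.natDegree < n → ∀ c, g.eval₂ i₂ c = 0 → ∃ s, i₂ s = c)
    {g : L[X]} (hg : g ≠ 0) (hdeg : g.natDegree = n) {a : R₁}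
    (ha : g.eval₂ i₁ a = 0) (hna : ∀ s, i₁ s ≠ a) :
    ∃ b, ∀ r : L[X], 0 ≤ r.eval₂ i₁ a ↔ 0 ≤ r.eval₂ i₂ b := by
  algebraize [i₁]
  have hfi : IsIntegral L a := isAlgebraic_iff_isIntegral.1 ⟨g, hg, ha⟩
  have hle : (minpoly L a).natDegree ≤ n :=
    hdeg ▸ natDegree_le_of_dvd (minpoly.dvd L a ha) hg
  have heq : (minpoly L a).natDegree = n := by
    refine hle.eq_of_not_lt fun hlt => ?_
    obtain ⟨s, hs⟩ := hroot₁ _ (minpoly.ne_zero hfi) hlt a (minpoly.aeval L a)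
    exact hna s hs
  have hn : 2 ≤ n := by
    rw [← heq, minpoly.two_le_natDegree_iff hfi]
    rintro ⟨s, hs⟩
    exact hna s hs
  obtain ⟨b, -, hb⟩ := h₁.exists_root_with_same_signs h₂ i₁ i₂ hord hn hroot₁ hroot₂
    (minpoly.irreducible hfi) (minpoly.monic hfi) heq (minpoly.aeval L a) hna
  exact ⟨b, hb⟩

/-- Uniqueness of real closures over a von Neumann regular ring of coefficients. -/
theorem exists_ringHom_comp_eq {A F₁ F₂ : Type*} [CommRing A] [Field F₁] [Field F₂]
    (hA : IsVonNeumannRegular A) (h₁ : IsRealClosedField F₁) (h₂ : IsRealClosedField F₂)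
    {j₁ : A →+* F₁} {j₂ : A →+* F₂} (hj₁ : j₁.IsIntegral) (hj₂ : j₂.IsIntegral)
    (hsq : ∀ a, (∃ y, y ^ 2 = j₁ a) ↔ ∃ y, y ^ 2 = j₂ a) :
    ∃ φ : F₁ →+* F₂, φ.comp j₁ = j₂ := by
  obtain ⟨o₁, ho₁⟩ := h₁.exists_linearOrder
  obtain ⟨o₂, ho₂⟩ := h₂.exists_linearOrder
  simp only [← h₁.nonneg_iff, ← h₂.nonneg_iff] at hsq
  obtain ⟨S, -, hS⟩ := zorn_le_nonempty₀
    {S : Subring (F₁ × F₂) | (j₁.prod j₂).range ≤ S ∧ ∀ z ∈ S, 0 ≤ z.1 ↔ 0 ≤ z.2} (by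
      intro c hc hchain y hy
      refine ⟨sSup c, ⟨(hc hy).1.trans (le_sSup hy), fun z hz => ?_⟩, fun z hz => le_sSup hz⟩
      obtain ⟨T, hT, hzT⟩ := (Subring.mem_sSup_of_directedOn ⟨y, hy⟩ hchain.directedOn).1 hz
      exact (hc hT).2 z hzT) (j₁.prod j₂).range ⟨le_rfl, by
        rintro _ ⟨a, rfl⟩
        exact hsq a⟩
  obtain ⟨hAS, hSord⟩ := hS.prop
  let i₁ : S →+* F₁ := (RingHom.fst F₁ F₂).comp S.subtype
  let i₂ : S →+* F₂ := (RingHom.snd F₁ F₂).comp S.subtype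
  let k : A →+* S := (j₁.prod j₂).codRestrict S fun a => hAS ⟨a, rfl⟩
  have hzero : ∀ s : S, i₁ s = 0 ↔ i₂ s = 0 := fun s => by
    have h := hSord s s.2
    have h' := hSord (-s) (S.neg_mem s.2)
    simp only [Prod.fst_neg, Prod.snd_neg, Left.nonneg_neg_iff] at h'
    exact ⟨fun h0 => le_antisymm (h'.1 h0.le) (h.1 h0.ge),
      fun h0 => le_antisymm (h'.2 h0.le) (h.2 h0.ge)⟩
  have hext : ∀ s t : S, i₁ s = i₁ t → s = t := fun s t hst => by
    refine Subtype.ext (Prod.ext hst (sub_eq_zero.1 ?_))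
    exact (hzero (s - t)).1 (by rw [map_sub, hst, sub_self])
  have hk : k.IsIntegral := fun s => by
    obtain ⟨p, hp, hps⟩ := hj₁ (i₁ s)
    refine ⟨p, hp, hext _ _ ?_⟩
    rw [hom_eval₂, map_zero]
    exact hps
  have : IsReduced S := isReduced_of_injective i₁ fun s t => hext s t
  have hSreg := hA.of_isIntegral hk
  have hfield : IsField S := by
    refine ⟨⟨0, 1, fun h => zero_ne_one (congrArg i₁ h)⟩, mul_comm, fun {s} hs => ?_⟩
    obtain ⟨b, hb⟩ := hSreg s
    refine ⟨b, hext _ _ ?_⟩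
    have hs0 : i₁ s ≠ 0 := fun h => hs (hext _ _ (by rw [h, map_zero]))
    have := congrArg i₁ hb
    simp only [map_mul, map_pow, map_one] at this ⊢
    exact mul_left_cancel₀ hs0 (by linear_combination -this)
  let : Field S := hfield.toField
  have hord : ∀ s, 0 ≤ i₁ s ↔ 0 ≤ i₂ s := fun s => hSord s s.2
  have hadj : ∀ a b, (∀ r : S[X], 0 ≤ r.eval₂ i₁ a ↔ 0 ≤ r.eval₂ i₂ b) → (a, b) ∈ S := by
    intro a b hab
    let ψ : S[X] →+* F₁ × F₂ := eval₂RingHom S.subtype (a, b)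
    have h1 : ∀ r, (ψ r).1 = r.eval₂ i₁ a := fun r => hom_eval₂ r _ (RingHom.fst F₁ F₂) _
    have h2 : ∀ r, (ψ r).2 = r.eval₂ i₂ b := fun r => hom_eval₂ r _ (RingHom.snd F₁ F₂) _
    have hle : S ≤ ψ.range := fun s hs => ⟨C ⟨s, hs⟩, by simp [ψ]⟩
    refine hS.le_of_ge (y := ψ.range) ⟨hAS.trans hle, ?_⟩ hle ⟨X, by simp [ψ]⟩
    rintro _ ⟨r, rfl⟩
    rw [h1, h2]
    exact hab r
  have hsurj : (∀ c, ∃ s, i₁ s = c) ∧ ∀ c, ∃ s, i₂ s = c := by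
    by_contra! hcon
    have hex : ∃ n, (∃ g : S[X], g ≠ 0 ∧ g.natDegree = n ∧ ∃ c, g.eval₂ i₁ c = 0 ∧ ∀ s, i₁ s ≠ c) ∨
        ∃ g : S[X], g ≠ 0 ∧ g.natDegree = n ∧ ∃ c, g.eval₂ i₂ c = 0 ∧ ∀ s, i₂ s ≠ c := by
      by_cases h : ∀ c, ∃ s, i₁ s = c
      · obtain ⟨c, hc⟩ := hcon h
        obtain ⟨p, hp, hpc⟩ := hj₂ c
        exact ⟨_, .inr ⟨p.map k, (hp.map k).ne_zero, rfl, c, by rw [eval₂_map]; exact hpc, hc⟩⟩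
      · push Not at h
        obtain ⟨c, hc⟩ := h
        obtain ⟨p, hp, hpc⟩ := hj₁ c
        exact ⟨_, .inl ⟨p.map k, (hp.map k).ne_zero, rfl, c, by rw [eval₂_map]; exact hpc, hc⟩⟩
    classical
    have hmin := fun m => Nat.find_min hex (m := m)
    push Not at hmin
    have hroot₁ := fun g h0 hlt c => (hmin _ hlt).1 g h0 rfl c
    have hroot₂ := fun g h0 hlt c => (hmin _ hlt).2 g h0 rfl c
    rcases Nat.find_spec hex with ⟨g, hg, hdeg, c, hc, hnc⟩ | ⟨g, hg, hdeg, c, hc, hnc⟩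
    · obtain ⟨b, hb⟩ := h₁.exists_pair_with_same_signs h₂ i₁ i₂ hord hroot₁ hroot₂ hg hdeg hc hnc
      exact hnc ⟨_, hadj c b hb⟩ rfl
    · obtain ⟨b, hb⟩ := h₂.exists_pair_with_same_signs h₁ i₂ i₁ (fun s => (hord s).symm)
        hroot₂ hroot₁ hg hdeg hc hnc
      exact hnc ⟨_, hadj b c fun r => (hb r).symm⟩ rfl
  let ε := RingEquiv.ofBijective i₁ ⟨i₁.injective, hsurj.1⟩
  refine ⟨i₂.comp ε.symm.toRingHom, RingHom.ext fun a => ?_⟩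
  have : ε.symm (j₁ a) = k a := by
    rw [RingEquiv.symm_apply_eq]
    rfl
  simp only [RingHom.comp_apply, RingEquiv.toRingHom_eq_coe, RingHom.coe_coe, this]
  rfl

end IsRealClosedField

namespace IsRealClosedField

open Polynomial

section Maximal

variable {M K : Type*} [Field M] [Field K] [IsAlgClosed K] (i : M →+* K) (Q : Subsemiring M)

theorem exists_sq_of_adjoin (hsq : ∀ x, x ^ 2 ∈ Q) (hneg : -1 ∉ Q)
    (hadj : ∀ a, (∀ s, i s ≠ a) →
      -1 ∈ AddSubmonoid.closure {z | ∃ t ∈ Q, ∃ g : M[X], z = i t * g.eval₂ i a ^ 2}) :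
    (∀ x ∈ Q, ∃ y : M, y ^ 2 = x) ∧ ∀ x : M, (∃ y, y ^ 2 = x) ∨ ∃ y, y ^ 2 = -x := by
  have hcon : ∀ x ∈ Q, -x ∈ Q → x = 0 := fun x hx hx' => by
    by_contra hx0
    refine hneg ?_
    have := Q.mul_mem (Q.mul_mem hx hx') (hsq x⁻¹)
    rwa [show x * -x * x⁻¹ ^ 2 = -1 by field_simp] at this
  have hnsq : ∀ x : M, (¬∃ y, y ^ 2 = x) → -x ∈ Q := fun x hx => by
    obtain ⟨r, hr⟩ := IsAlgClosed.exists_pow_nat_eq (i x) two_pos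
    have hri : ∀ s, i s ≠ r := fun s hs => hx ⟨s, i.injective (by rw [map_pow, hs, hr])⟩
    have heval : ∀ g : M[X], ∃ u v, g.eval₂ i r = i u + r * i v := fun g => by
      induction g using Polynomial.induction_on with
      | C a => exact ⟨a, 0, by simp⟩
      | add p q hp hq =>
        obtain ⟨u, v, h⟩ := hp
        obtain ⟨u', v', h'⟩ := hq
        exact ⟨u + u', v + v', by rw [eval₂_add, h, h', map_add, map_add]; ring⟩
      | monomial n a h =>
        obtain ⟨u, v, h⟩ := h
        refine ⟨x * v, u, ?_⟩
        rw [pow_succ, ← mul_assoc, eval₂_mul, h, eval₂_X, map_mul, ← hr]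
        ring
    have hform : ∀ z ∈ AddSubmonoid.closure {z | ∃ t ∈ Q, ∃ g : M[X], z = i t * g.eval₂ i r ^ 2},
        ∃ s ∈ Q, ∃ t ∈ Q, ∃ m, z = i (s + x * t) + r * i m := fun z hz => by
      induction hz using AddSubmonoid.closure_induction with
      | mem z hz =>
        obtain ⟨t, ht, g, rfl⟩ := hz
        obtain ⟨u, v, h⟩ := heval g
        refine ⟨t * u ^ 2, Q.mul_mem ht (hsq u), t * v ^ 2, Q.mul_mem ht (hsq v), t * (2 * u * v),
          ?_⟩
        simp only [h, map_add, map_mul, map_pow, map_ofNat, ← hr]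
        ring
      | zero => exact ⟨0, Q.zero_mem, 0, Q.zero_mem, 0, by simp⟩
      | add y z _ _ hy hz =>
        obtain ⟨s, hs, t, ht, m, rfl⟩ := hy
        obtain ⟨s', hs', t', ht', m', rfl⟩ := hz
        refine ⟨s + s', Q.add_mem hs hs', t + t', Q.add_mem ht ht', m + m', ?_⟩
        simp only [map_add, map_mul]
        ring
    obtain ⟨s, hs, t, ht, m, h⟩ := hform _ (hadj r hri)
    have hm : m = 0 := by
      by_contra hm
      refine hri (-(1 + (s + x * t)) / m) ?_
      rw [map_div₀, div_eq_iff ((map_ne_zero i).2 hm), map_neg, map_add, map_one]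
      linear_combination h
    have hst : s + x * t = -1 := i.injective (by rw [map_neg, map_one, h, hm]; simp)
    have ht0 : t ≠ 0 := by
      rintro rfl
      refine hneg ?_
      rwa [← hst, mul_zero, add_zero]
    have := Q.mul_mem (Q.mul_mem (Q.add_mem Q.one_mem hs) ht) (hsq t⁻¹)
    convert this using 1
    field_simp
    linear_combination -hst
  have hQ : ∀ x ∈ Q, ∃ y : M, y ^ 2 = x := fun x hx => by
    by_contra h
    exact h ⟨0, by rw [hcon x hx (hnsq x h)]; simp⟩
  refine ⟨hQ, fun x => ?_⟩
  by_cases h : ∃ y : M, y ^ 2 = x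
  · exact .inl h
  · exact .inr (hQ _ (hnsq x h))

theorem exists_root_of_adjoin (hreal : IsRealRing M)
    (htot : ∀ x : M, (∃ y, y ^ 2 = x) ∨ ∃ y, y ^ 2 = -x)
    (hadj : ∀ a, (∀ s, i s ≠ a) →
      -1 ∈ AddSubmonoid.closure {z | ∃ t : M, ∃ g : M[X], z = i t ^ 2 * g.eval₂ i a ^ 2})
    (p : M[X]) (hp : Odd p.natDegree) : ∃ x, p.eval x = 0 := by
  have hsqadd : ∀ x y : M, ∃ z, z ^ 2 = x ^ 2 + y ^ 2 := fun x y => by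
    rcases htot (x ^ 2 + y ^ 2) with h | ⟨z, hz⟩
    · exact h
    · have := hreal 3 ![x, y, z] (by simp [Fin.sum_univ_three, hz])
      have hx : x = 0 := by simpa using this 0
      have hy : y = 0 := by simpa using this 1
      exact ⟨0, by simp [hx, hy]⟩
  have hsum : ∀ x y : M, x ^ 2 + y ^ 2 = 0 → x = 0 ∧ y = 0 := fun x y => sq_add_sq_eq_zero hreal
  have hadd : ∀ n, ∀ G H : M[X], (Even G.natDegree ∧ G.natDegree + 2 ≤ 2 * n ∧
        (∃ y, y ^ 2 = G.leadingCoeff) ∧ ∀ c, ∃ y, y ^ 2 = G.eval c) →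
      (Even H.natDegree ∧ H.natDegree + 2 ≤ 2 * n ∧
        (∃ y, y ^ 2 = H.leadingCoeff) ∧ ∀ c, ∃ y, y ^ 2 = H.eval c) →
      Even (G + H).natDegree ∧ (G + H).natDegree + 2 ≤ 2 * n ∧
        (∃ y, y ^ 2 = (G + H).leadingCoeff) ∧ ∀ c, ∃ y, y ^ 2 = (G + H).eval c := by
    rintro n G H ⟨hG, hGn, hGl, hGc⟩ ⟨hH, hHn, hHl, hHc⟩
    rw [← and_assoc, ← and_assoc, and_assoc (a := Even _)]
    refine ⟨?_, fun c => ?_⟩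
    · rcases lt_trichotomy G.natDegree H.natDegree with h | h | h
      · rw [natDegree_add_eq_right_of_natDegree_lt h, leadingCoeff_add_of_degree_lt
          (degree_lt_degree h)]
        exact ⟨hH, hHn, hHl⟩
      · obtain ⟨y, hy⟩ := hGl
        obtain ⟨z, hz⟩ := hHl
        by_cases h0 : G.leadingCoeff + H.leadingCoeff = 0
        · rw [← hy, ← hz] at h0
          obtain ⟨rfl, rfl⟩ := hsum y z h0
          have hG0 : G = 0 := leadingCoeff_eq_zero.1 (by rw [← hy]; simp)
          have hH0 : H = 0 := leadingCoeff_eq_zero.1 (by rw [← hz]; simp)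
          subst hG0 hH0
          exact ⟨by simp, by simpa using hGn, 0, by simp⟩
        · have hc : (G + H).coeff G.natDegree = G.leadingCoeff + H.leadingCoeff := by
            rw [coeff_add, leadingCoeff, leadingCoeff, ← h]
          have hnd : (G + H).natDegree = G.natDegree := by
            refine le_antisymm ((natDegree_add_le G H).trans (by omega)) ?_
            exact le_natDegree_of_ne_zero (hc ▸ h0)
          have hlc : (G + H).leadingCoeff = G.leadingCoeff + H.leadingCoeff := by
            rw [← hc, leadingCoeff, hnd]
          rw [hnd, hlc, ← hy, ← hz]
          exact ⟨hG, hGn, hsqadd y z⟩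
      · rw [natDegree_add_eq_left_of_natDegree_lt h, leadingCoeff_add_of_degree_lt'
          (degree_lt_degree h)]
        exact ⟨hG, hGn, hGl⟩
    · obtain ⟨y, hy⟩ := hGc c
      obtain ⟨z, hz⟩ := hHc c
      rw [eval_add, ← hy, ← hz]
      exact hsqadd y z
  induction hn : p.natDegree using Nat.strong_induction_on generalizing p with
  | _ n ih =>
  by_cases hirr : Irreducible p
  swap
  · have hp0 : p ≠ 0 := by
      rintro rfl
      simp at hp
    have hu : ¬IsUnit p := fun h => by
      rw [natDegree_eq_zero_of_isUnit h] at hp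
      simp at hp
    rw [irreducible_iff] at hirr
    push Not at hirr
    obtain ⟨q, r, rfl, hq, hr⟩ := hirr hu
    have hq0 := left_ne_zero_of_mul hp0
    have hr0 := right_ne_zero_of_mul hp0
    rw [natDegree_mul hq0 hr0] at hn hp
    have hqd := natDegree_pos_iff_degree_pos.2 (degree_pos_of_ne_zero_of_nonunit hq0 hq)
    have hrd := natDegree_pos_iff_degree_pos.2 (degree_pos_of_ne_zero_of_nonunit hr0 hr)
    rcases Nat.even_or_odd q.natDegree with hqe | hqo
    · obtain ⟨x, hx⟩ := ih r.natDegree (by omega) r (by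
        rw [add_comm] at hp
        exact (Nat.odd_add.1 hp).2 hqe) rfl
      exact ⟨x, by simp [hx]⟩
    · obtain ⟨x, hx⟩ := ih q.natDegree (by omega) q hqo rfl
      exact ⟨x, by simp [hx]⟩
  have hpos := hirr.natDegree_pos
  by_cases h1 : p.natDegree = 1
  · exact exists_root_of_degree_eq_one (degree_eq_iff_natDegree_eq_of_pos one_pos |>.2 h1)
  obtain ⟨a, ha⟩ := IsAlgClosed.exists_eval₂_eq_zero i p fun h =>
    hpos.ne' (natDegree_eq_of_degree_eq_some h)
  have hai : ∀ s, i s ≠ a := by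
    rintro s rfl
    rw [eval₂_at_apply, map_eq_zero] at ha
    exact h1 (natDegree_eq_of_degree_eq_some (degree_eq_one_of_irreducible_of_root hirr ha))
  have hform : ∀ z ∈ AddSubmonoid.closure {z | ∃ t : M, ∃ g : M[X], z = i t ^ 2 * g.eval₂ i a ^ 2},
      ∃ G : M[X], z = G.eval₂ i a ∧ Even G.natDegree ∧ G.natDegree + 2 ≤ 2 * n ∧
        (∃ y, y ^ 2 = G.leadingCoeff) ∧ ∀ c, ∃ y, y ^ 2 = G.eval c := fun z hz => by
    induction hz using AddSubmonoid.closure_induction with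
    | mem z hz =>
      obtain ⟨t, g, rfl⟩ := hz
      have hmod := EuclideanDomain.div_add_mod g p
      have hlt : (g % p).natDegree < n := by
        rw [← hn]
        by_cases h : g % p = 0
        · rw [h]
          exact hpos
        · exact natDegree_lt_natDegree h (EuclideanDomain.mod_lt g hirr.ne_zero)
      have heval : g.eval₂ i a = (g % p).eval₂ i a := by
        conv_lhs => rw [← hmod]
        rw [eval₂_add, eval₂_mul, ha, zero_mul, zero_add]
      refine ⟨(C t * (g % p)) ^ 2, ?_, ?_, ?_, ⟨_, (leadingCoeff_pow _ _).symm⟩,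
        fun c => ⟨_, (eval_pow _).symm⟩⟩
      · rw [heval, eval₂_pow, eval₂_mul, eval₂_C, mul_pow]
      · rw [natDegree_pow]
        exact even_two_mul _
      · rw [natDegree_pow]
        have := natDegree_C_mul_le t (g % p)
        omega
    | zero => exact ⟨0, by simp, by simp, by simp; omega, ⟨0, by simp⟩, fun c => ⟨0, by simp⟩⟩
    | add y z _ _ hy hz =>
      obtain ⟨G, rfl, hG⟩ := hy
      obtain ⟨H, rfl, hH⟩ := hz
      refine ⟨G + H, (eval₂_add _ _).symm, hadd n G H hG hH⟩
  obtain ⟨G, hG, hG'⟩ := hform _ (hadj a hai)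
  have hne : G + 1 ≠ 0 := fun h0 => by
    obtain ⟨y, hy⟩ := hG'.2.2.2 0
    have h00 : G.eval 0 + 1 = 0 := by simpa using congrArg (eval 0) h0
    exact one_ne_zero (hsum y 1 (by rw [hy, one_pow, h00])).2
  have hG1 := hadd n G 1 hG' ⟨by simp, by simp; omega, ⟨1, by simp⟩, fun c => ⟨1, by simp⟩⟩
  have hdvd : p ∣ G + 1 := by
    by_contra hndvd
    obtain ⟨u, v, huv⟩ := hirr.coprime_iff_not_dvd.2 hndvd
    have := congrArg (eval₂ i a) huv
    rw [eval₂_add, eval₂_mul, eval₂_mul, eval₂_add, ha, ← hG] at this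
    simp at this
  obtain ⟨h, hh⟩ := hdvd
  have hdeg := congrArg natDegree hh
  rw [natDegree_mul hirr.ne_zero (by rintro rfl; simp [hne] at hh)] at hdeg
  obtain ⟨c, hc⟩ := ih h.natDegree (by omega) h (by
    have h2 := hG1.1
    rw [hdeg, Nat.even_add] at h2
    exact Nat.not_even_iff_odd.1 fun h3 => Nat.not_even_iff_odd.2 hp (h2.2 h3)) rfl
  obtain ⟨y, hy⟩ := hG'.2.2.2 c
  have := congrArg (eval c) hh
  rw [eval_mul, hc, mul_zero, eval_add, eval_one, ← hy] at this
  exact absurd (hsum y 1 (by rw [one_pow, this])).2 one_ne_zero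

end Maximal

/-- Every field with a proper preordering has a real closed algebraic extension in which the
elements of the preordering are squares. -/
theorem exists_of_preordering {k K : Type u} [Field k] [Field K] [IsAlgClosed K] {i : k →+* K}
    (hi : i.IsIntegral) (T : Subsemiring k) (hsq : ∀ x, x ^ 2 ∈ T) (hT : -1 ∉ T) :
    ∃ (L : Type u) (_ : Field L) (φ : k →+* L), φ.IsIntegral ∧ IsRealClosedField L ∧ ∀ t ∈ T, ∃ y, y ^ 2 = φ t := by
  have h2 : (2 : K) ≠ 0 := fun h => hT (by
    have : (2 : k) = 0 := i.injective (by rw [map_ofNat, h, map_zero])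
    rw [show (-1 : k) = 1 ^ 2 by linear_combination -this]
    exact hsq 1)
  obtain ⟨Q, hTQ, hQ⟩ := zorn_le_nonempty₀
    {Q : Subsemiring K | -1 ∉ Q ∧ ∀ x ∈ Q, ∀ y ∈ Q, (x - y) ^ 2 ∈ Q} (by
      intro c hc hchain R hR
      refine ⟨sSup c, ⟨fun h => ?_, fun x hx y hy => ?_⟩, fun z hz => le_sSup hz⟩
      · obtain ⟨S, hS, hxS⟩ := (Subsemiring.mem_sSup_of_directedOn ⟨R, hR⟩ hchain.directedOn).1 h
        exact (hc hS).1 hxS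
      · obtain ⟨S, hS, hxS⟩ := (Subsemiring.mem_sSup_of_directedOn ⟨R, hR⟩ hchain.directedOn).1 hx
        obtain ⟨S', hS', hyS⟩ := (Subsemiring.mem_sSup_of_directedOn ⟨R, hR⟩ hchain.directedOn).1 hy
        obtain ⟨U, hU, h, h'⟩ := hchain.directedOn S hS S' hS'
        exact le_sSup hU ((hc hU).2 x (h hxS) y (h' hyS)))
    (T.map i) ⟨by
      rintro ⟨t, ht, h⟩
      refine hT ?_
      rwa [← i.injective (a₁ := t) (a₂ := -1) (by rw [h, map_neg, map_one])], by
      rintro _ ⟨x, hx, rfl⟩ _ ⟨y, hy, rfl⟩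
      exact ⟨(x - y) ^ 2, hsq _, by simp⟩⟩
  obtain ⟨hneg, hQsq⟩ := hQ.prop
  let S : Subring K :=
    { carrier := {z | ∃ x ∈ Q, ∃ y ∈ Q, z = x - y}
      mul_mem' := by
        rintro _ _ ⟨x, hx, y, hy, rfl⟩ ⟨x', hx', y', hy', rfl⟩
        exact ⟨_, Q.add_mem (Q.mul_mem hx hx') (Q.mul_mem hy hy'), _,
          Q.add_mem (Q.mul_mem hx hy') (Q.mul_mem hy hx'), by ring⟩
      one_mem' := ⟨1, Q.one_mem, 0, Q.zero_mem, by simp⟩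
      add_mem' := by
        rintro _ _ ⟨x, hx, y, hy, rfl⟩ ⟨x', hx', y', hy', rfl⟩
        exact ⟨_, Q.add_mem hx hx', _, Q.add_mem hy hy', by ring⟩
      zero_mem' := ⟨0, Q.zero_mem, 0, Q.zero_mem, by simp⟩
      neg_mem' := by
        rintro _ ⟨x, hx, y, hy, rfl⟩
        exact ⟨y, hy, x, hx, by ring⟩ }
  have hQS : ∀ x ∈ Q, x ∈ S := fun x hx => ⟨x, hx, 0, Q.zero_mem, by simp⟩
  have hdiff : ∀ x : K, x = ((x + 1) / 2) ^ 2 - ((x - 1) / 2) ^ 2 := fun x => by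
    field_simp
    ring
  have hkS : ∀ x : k, i x ∈ S := fun x => by
    refine ⟨_, hTQ ⟨_, hsq ((x + 1) / 2), rfl⟩, _, hTQ ⟨_, hsq ((x - 1) / 2), rfl⟩, ?_⟩
    rw [map_pow, map_pow, map_div₀, map_div₀, map_add, map_sub, map_one, map_ofNat]
    exact hdiff (i x)
  let φ : k →+* S := i.codRestrict S hkS
  have hφ : φ.IsIntegral := fun s => by
    obtain ⟨p, hp, hps⟩ := hi (s : K)
    refine ⟨p, hp, Subtype.ext ?_⟩
    exact (hom_eval₂ p φ S.subtype s).trans hps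
  have hSreg := (IsVonNeumannRegular.of_isField (Field.toIsField k)).of_isIntegral hφ
  have hfield : IsField S := by
    refine ⟨⟨0, 1, zero_ne_one⟩, mul_comm, fun {s} hs => ?_⟩
    obtain ⟨b, hb⟩ := hSreg s
    exact ⟨b, mul_left_cancel₀ hs (by linear_combination -hb)⟩
  let : Field S := hfield.toField
  let Q' : Subsemiring S := Q.comap S.subtype
  have hQ'sq : ∀ x, x ^ 2 ∈ Q' := by
    rintro ⟨_, x, hx, y, hy, rfl⟩
    exact hQsq x hx y hy
  have hadj : ∀ a : K, (∀ s, S.subtype s ≠ a) → -1 ∈ AddSubmonoid.closure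
      {z | ∃ t ∈ Q', ∃ g : S[X], z = S.subtype t * g.eval₂ S.subtype a ^ 2} := by
    intro a ha
    let N : Submonoid K :=
      { carrier := {z | ∃ t ∈ Q', ∃ g : S[X], z = S.subtype t * g.eval₂ S.subtype a ^ 2}
        one_mem' := ⟨1, Q'.one_mem, 1, by simp⟩
        mul_mem' := by
          rintro _ _ ⟨t, ht, g, rfl⟩ ⟨t', ht', g', rfl⟩
          refine ⟨_, Q'.mul_mem ht ht', g * g', ?_⟩
          rw [eval₂_mul, map_mul]
          ring }
    let E := N.subsemiringClosure
    change -1 ∈ E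
    by_contra hE
    have hNE : ∀ z ∈ N, z ∈ E := fun z hz => AddSubmonoid.subset_closure hz
    have hgE : ∀ g : S[X], g.eval₂ S.subtype a ^ 2 ∈ E := fun g =>
      hNE _ ⟨1, Q'.one_mem, g, by simp⟩
    have hEg : ∀ z ∈ E, ∃ g : S[X], z = g.eval₂ S.subtype a := fun z hz => by
      induction hz using AddSubmonoid.closure_induction with
      | mem z hz =>
        obtain ⟨t, ht, g, rfl⟩ := hz
        exact ⟨C t * g ^ 2, by rw [eval₂_mul, eval₂_C, eval₂_pow]⟩
      | zero => exact ⟨0, by simp⟩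
      | add y z _ _ hy hz =>
        obtain ⟨g, rfl⟩ := hy
        obtain ⟨g', rfl⟩ := hz
        exact ⟨g + g', by simp⟩
    have hEQ : E ≤ Q := hQ.le_of_ge (y := E) ⟨hE, fun x hx y hy => by
      obtain ⟨g, rfl⟩ := hEg x hx
      obtain ⟨g', rfl⟩ := hEg y hy
      rw [← eval₂_sub]
      exact hgE _⟩ fun x hx => hNE _ ⟨⟨x, hQS x hx⟩, hx, 1, by simp⟩
    have ha2 : a ∈ S := by
      refine ⟨_, hEQ (hgE (C (1 / 2) * (X + 1))), _, hEQ (hgE (C (1 / 2) * (X - 1))), ?_⟩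
      rw [eval₂_mul, eval₂_mul, eval₂_C, eval₂_add, eval₂_sub, eval₂_X, eval₂_one, map_div₀,
        map_one, map_ofNat]
      field_simp
      ring
    exact ha ⟨a, ha2⟩ rfl
  have hneg' : -1 ∉ Q' := fun h => hneg (by simpa [Q'] using h)
  obtain ⟨hsq', htot⟩ := exists_sq_of_adjoin S.subtype Q' hQ'sq hneg' hadj
  have hreal : IsRealRing S := by
    intro n f hf j
    by_contra hj
    refine hneg' ?_
    classical
    have h0 : (f j / f j) ^ 2 + ∑ i ∈ Finset.univ.erase j, (f i / f j) ^ 2 = 0 := by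
      rw [Finset.add_sum_erase _ (fun i => (f i / f j) ^ 2) (Finset.mem_univ j)]
      simp only [div_pow, ← Finset.sum_div, hf, zero_div]
    rw [div_self hj] at h0
    rw [show (-1 : S) = ∑ i ∈ Finset.univ.erase j, (f i / f j) ^ 2 by linear_combination -h0]
    exact Q'.sum_mem fun i _ => hQ'sq _
  refine ⟨S, inferInstance, φ, hφ, ⟨hreal, htot, exists_root_of_adjoin S.subtype hreal htot
    fun a ha => ?_⟩, fun t ht => hsq' _ (hTQ ⟨t, ht, rfl⟩)⟩
  refine AddSubmonoid.closure_mono ?_ (hadj a ha)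
  rintro _ ⟨t, ht, g, rfl⟩
  obtain ⟨y, rfl⟩ := hsq' t ht
  exact ⟨y, g, by rw [map_pow]⟩

end IsRealClosedField

theorem IsVonNeumannRegular.exists_comap_eq {R S : Type*} [CommRing R] [CommRing S]
    (hR : IsVonNeumannRegular R) {f : R →+* S} (hf : Function.Injective f) (q : Ideal R)
    [hq : q.IsPrime] : ∃ 𝔭 : Ideal S, 𝔭.IsPrime ∧ 𝔭.comap f = q :=
  Ideal.exists_comap_eq_of_mem_minimalPrimes_of_injective hf q
    ⟨⟨hq, bot_le⟩, fun p hp hle => by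
      have := hp.1
      exact ((hR.isMaximal p).eq_of_le hq.ne_top hle).ge⟩

/-- A real von Neumann regular ring all of whose residue fields are real closed, expressed by
global conditions. -/
structure IsPointwiseRealClosed (R : Type*) [CommRing R] : Prop where
  vnr : IsVonNeumannRegular R
  real : IsRealRing R
  decomp : ∀ b : R, ∃ e, IsIdempotentElem e ∧ (∃ y, y ^ 2 = e * b) ∧ ∃ y, y ^ 2 = -((1 - e) * b)
  root : ∀ p : Polynomial R, p.Monic → Odd p.natDegree → ∃ x, p.eval x = 0

namespace IsPointwiseRealClosed

open Polynomial

variable {R : Type u} [CommRing R]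

theorem exists_sq_eq_add (hR : IsPointwiseRealClosed R) (x y : R) :
    ∃ z, z ^ 2 = x ^ 2 + y ^ 2 := by
  obtain ⟨e, he, ⟨z, hz⟩, w, hw⟩ := hR.decomp (x ^ 2 + y ^ 2)
  have he' : (1 - e) * (1 - e) = 1 - e := he.one_sub
  have h0 := hR.real 3 ![(1 - e) * x, (1 - e) * y, w] (by
    simp [Fin.sum_univ_three, hw]
    linear_combination (x ^ 2 + y ^ 2) * he')
  have hx : (1 - e) * x = 0 := by simpa using h0 0
  have hy : (1 - e) * y = 0 := by simpa using h0 1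
  exact ⟨z, by linear_combination hz - x * hx - y * hy⟩

theorem mem_iff_exists_sq (hR : IsPointwiseRealClosed R) {Q : Set R} (hQ : IsPartialOrdering Q)
    (b : R) : b ∈ Q ↔ ∃ y, y ^ 2 = b := by
  obtain ⟨-, hmul, hsq, hneg⟩ := hQ
  constructor
  · intro hb
    obtain ⟨e, he, ⟨y, hy⟩, z, hz⟩ := hR.decomp b
    have h1 : (1 - e) * b ∈ Q := by
      rw [← he.one_sub.eq, ← pow_two]
      exact hmul _ (hsq _) _ hb
    have h2 := hneg _ h1 (hz ▸ hsq z)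
    exact ⟨y, by linear_combination hy - h2⟩
  · rintro ⟨y, rfl⟩
    exact hsq y

theorem isPartialOrdering_squares (hR : IsPointwiseRealClosed R) :
    IsPartialOrdering {b : R | ∃ y, y ^ 2 = b} := by
  refine ⟨?_, ?_, fun a => ⟨a, rfl⟩, ?_⟩
  · rintro _ ⟨x, rfl⟩ _ ⟨y, rfl⟩
    exact hR.exists_sq_eq_add x y
  · rintro _ ⟨x, rfl⟩ _ ⟨y, rfl⟩
    exact ⟨x * y, mul_pow x y 2⟩
  · rintro _ ⟨x, rfl⟩ ⟨y, hy⟩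
    rw [(IsRealClosedField.sq_add_sq_eq_zero hR.real (x := x) (y := y) (by rw [hy]; ring)).1]
    simp

theorem exists_isRealClosedField (hR : IsPointwiseRealClosed R) (q : Ideal R) [q.IsPrime] :
    ∃ h : IsField (R ⧸ q), @IsRealClosedField (R ⧸ q) h.toField := by
  have hfield : IsField (R ⧸ q) :=
    (Ideal.Quotient.maximal_ideal_iff_isField_quotient q).1 (hR.vnr.isMaximal q)
  refine ⟨hfield, ?_⟩
  let : Field (R ⧸ q) := hfield.toField
  refine ⟨hR.real.quotient hR.vnr q, fun x => ?_, fun p hp => ?_⟩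
  · obtain ⟨b, rfl⟩ := Ideal.Quotient.mk_surjective x
    obtain ⟨e, he, ⟨y, hy⟩, z, hz⟩ := hR.decomp b
    have hy' := congrArg (Ideal.Quotient.mk q) hy
    have hz' := congrArg (Ideal.Quotient.mk q) hz
    simp only [map_pow, map_mul, map_neg, map_sub, map_one] at hy' hz'
    rcases IsIdempotentElem.iff_eq_zero_or_one.1 (he.map (Ideal.Quotient.mk q)) with h | h
    · exact .inr ⟨_, hz'.trans (by rw [h]; ring)⟩
    · exact .inl ⟨_, hy'.trans (by rw [h]; ring)⟩
  · have hp0 : p ≠ 0 := by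
      rintro rfl
      simp at hp
    have hmon : (p * C p.leadingCoeff⁻¹).Monic := monic_mul_leadingCoeff_inv hp0
    have hlift : p * C p.leadingCoeff⁻¹ ∈ lifts (Ideal.Quotient.mk q) := by
      rw [lifts_iff_coeff_lifts]
      exact fun n => Ideal.Quotient.mk_surjective _
    obtain ⟨P, hP, hdeg, hPm⟩ := lifts_and_natDegree_eq_and_monic hlift hmon
    obtain ⟨x, hx⟩ := hR.root P hPm (by
      rwa [hdeg, natDegree_mul_leadingCoeff_inv _ hp0])
    refine ⟨Ideal.Quotient.mk q x, ?_⟩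
    have := congrArg (Ideal.Quotient.mk q) hx
    rw [← eval_map_apply, hP, eval_mul, eval_C, map_zero] at this
    exact (mul_eq_zero.1 this).resolve_right (inv_ne_zero (leadingCoeff_ne_zero.2 hp0))

theorem of_ringEquiv {S : Type*} [CommRing S] (hR : IsPointwiseRealClosed R) (ε : R ≃+* S) :
    IsPointwiseRealClosed S where
  vnr x := by
    obtain ⟨y, hy⟩ := hR.vnr (ε.symm x)
    exact ⟨ε y, by simpa using congrArg ε hy⟩
  real := hR.real.of_injective (f := ε.symm.toRingHom) ε.symm.injective
  decomp b := by
    obtain ⟨e, he, ⟨y, hy⟩, z, hz⟩ := hR.decomp (ε.symm b)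
    exact ⟨ε e, he.map ε, ⟨ε y, by simpa using congrArg ε hy⟩, ε z, by simpa using congrArg ε hz⟩
  root p hp hodd := by
    obtain ⟨x, hx⟩ := hR.root (p.map ε.symm.toRingHom) (hp.map _) (by
      rwa [natDegree_map_eq_of_injective ε.symm.injective])
    obtain ⟨x, rfl⟩ := ε.symm.surjective x
    refine ⟨x, ε.symm.injective ?_⟩
    rw [map_zero, ← hx]
    exact (eval_map_apply ε.symm.toRingHom x).symm

theorem pi {ι : Type*} {K : ι → Type u} [∀ i, Field (K i)] (hK : ∀ i, IsRealClosedField (K i)) :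
    IsPointwiseRealClosed (∀ i, K i) where
  vnr := .pi fun i => .of_isField (Field.toIsField (K i))
  real := .pi fun i => (hK i).1
  decomp b := by
    have h : ∀ i, ∃ e : K i, IsIdempotentElem e ∧ (∃ y, y ^ 2 = e * b i) ∧
        ∃ y, y ^ 2 = -((1 - e) * b i) := fun i => by
      rcases (hK i).2.1 (b i) with ⟨y, hy⟩ | ⟨y, hy⟩
      · exact ⟨1, .one, ⟨y, by simpa using hy⟩, 0, by simp⟩
      · exact ⟨0, .zero, ⟨0, by simp⟩, y, by simpa using hy⟩
    choose e he using h
    choose y hy using fun i => (he i).2.1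
    choose z hz using fun i => (he i).2.2
    exact ⟨e, funext fun i => (he i).1, ⟨y, funext hy⟩, z, funext hz⟩
  root p hp hodd := by
    choose x hx using fun i => (hK i).2.2 (p.map (Pi.evalRingHom K i)) (by
      rwa [hp.natDegree_map])
    refine ⟨x, funext fun i => ?_⟩
    exact (eval_map_apply (Pi.evalRingHom K i) x).symm.trans (hx i)

theorem quotient (hR : IsPointwiseRealClosed R) (I : Ideal R) : IsPointwiseRealClosed (R ⧸ I) where
  vnr := hR.vnr.quotient I
  real := hR.real.quotient hR.vnr I
  decomp b := by
    obtain ⟨b, rfl⟩ := Ideal.Quotient.mk_surjective b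
    obtain ⟨e, he, ⟨y, hy⟩, z, hz⟩ := hR.decomp b
    exact ⟨Ideal.Quotient.mk I e, he.map _, ⟨Ideal.Quotient.mk I y, by rw [← map_pow, hy, map_mul]⟩,
      Ideal.Quotient.mk I z, by rw [← map_pow, hz]; simp⟩
  root p hp hodd := by
    rcases subsingleton_or_nontrivial (R ⧸ I) with _ | _
    · exact ⟨0, Subsingleton.elim _ _⟩
    have hlift : p ∈ lifts (Ideal.Quotient.mk I) := by
      rw [lifts_iff_coeff_lifts]
      exact fun n => Ideal.Quotient.mk_surjective _
    obtain ⟨P, rfl, hdeg, hPm⟩ := lifts_and_natDegree_eq_and_monic hlift hp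
    obtain ⟨x, hx⟩ := hR.root P hPm (hdeg ▸ hodd)
    exact ⟨Ideal.Quotient.mk I x, by rw [eval_map_apply, hx, map_zero]⟩

end IsPointwiseRealClosed

theorem IsEssentialExtension.comp {A B C : Type*} [CommRing A] [CommRing B] [CommRing C]
    {g : B →+* C} {f : A →+* B} (hg : IsEssentialExtension g) (hf : IsEssentialExtension f) :
    IsEssentialExtension (g.comp f) := by
  refine ⟨hg.1.comp hf.1, fun J hJ => ?_⟩
  obtain ⟨b, hb, hb0⟩ := hg.2 J hJ
  obtain ⟨a, ha, ha0⟩ := hf.2 (J.comap g) fun h => hb0 (by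
    have : b ∈ J.comap g := hb
    rw [h, Ideal.mem_bot] at this
    rw [this, map_zero])
  exact ⟨a, ha, fun h => ha0 (hg.1 (by rw [map_zero]; exact h))⟩

theorem IsEssentialExtension.exists_eq_mul {A B : Type*} [CommRing A] [CommRing B] {f : A →+* B}
    (hf : IsEssentialExtension f) {b : B} (hb : b ≠ 0) : ∃ a y, f a = b * y ∧ f a ≠ 0 := by
  obtain ⟨a, ha, ha0⟩ := hf.2 (Ideal.span {b}) (by simpa using hb)
  obtain ⟨y, hy⟩ := Ideal.mem_span_singleton.1 ha
  exact ⟨a, y, hy, ha0⟩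

namespace RingHom

open Polynomial

variable {A D : Type*} [CommRing A] [CommRing D] (h : A →+* D)

/-- The integral closure of the image of a ring homomorphism, as a subring of the codomain. -/
def integralSubring : Subring D where
  carrier := {x | h.IsIntegralElem x}
  mul_mem' hx hy := hx.mul h hy
  one_mem' := h.isIntegralElem_one
  add_mem' hx hy := hx.add h hy
  zero_mem' := h.isIntegralElem_zero
  neg_mem' hx := hx.neg h

/-- The corestriction of a ring homomorphism to the integral closure of its image. -/
def toIntegralSubring : A →+* h.integralSubring :=
  h.codRestrict h.integralSubring fun _ => h.isIntegralElem_map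

variable {h}

theorem isIntegral_toIntegralSubring : h.toIntegralSubring.IsIntegral := fun x => by
  obtain ⟨p, hp, hpx⟩ := x.2
  refine ⟨p, hp, Subtype.ext ?_⟩
  exact (hom_eval₂ p h.toIntegralSubring h.integralSubring.subtype x).trans hpx

theorem mem_integralSubring_of_isIntegralElem {x : D}
    (hx : h.integralSubring.subtype.IsIntegralElem x) : x ∈ h.integralSubring := by
  let := h.toAlgebra
  let := h.toIntegralSubring.toAlgebra
  have : Algebra.IsIntegral A h.integralSubring := ⟨isIntegral_toIntegralSubring⟩
  have : IsScalarTower A h.integralSubring D := .of_algebraMap_eq fun _ => rfl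
  exact isIntegral_trans (R := A) (A := h.integralSubring) x hx

theorem mem_integralSubring_of_sq {x : D} (hx : x ^ 2 ∈ h.integralSubring) :
    x ∈ h.integralSubring := by
  refine mem_integralSubring_of_isIntegralElem ⟨X ^ 2 - C ⟨x ^ 2, hx⟩, ?_, ?_⟩
  · exact monic_X_pow_sub_C _ two_ne_zero
  · simp

theorem mem_integralSubring_of_isIdempotentElem {e : D} (he : IsIdempotentElem e) :
    e ∈ h.integralSubring :=
  ⟨X ^ 2 - X, monic_X_pow_sub (degree_X_le.trans_lt (by norm_num)), by simp [pow_two, he.eq]⟩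

/-- Integral elements can be lifted along quotients of von Neumann regular rings. -/
theorem exists_mem_integralSubring_eq (hD : IsVonNeumannRegular D) {E : Type*} [CommRing E]
    [IsDomain E] {ψ : D →+* E} (hψ : Function.Surjective ψ) {x : E}
    (hx : (ψ.comp h).IsIntegralElem x) : ∃ c ∈ h.integralSubring, ψ c = x := by
  obtain ⟨d, rfl⟩ := hψ x
  obtain ⟨p, hp, hpd⟩ := hx
  have hker : p.eval₂ h d ∈ ker ψ := by
    rw [mem_ker, hom_eval₂, hpd]
  obtain ⟨e, he, heψ, hed⟩ := hD.exists_isIdempotentElem_notMem (ker_ne_top ψ) hker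
  have hψe : ψ e = 1 :=
    (IsIdempotentElem.iff_eq_zero_or_one.1 (he.map ψ)).resolve_left heψ
  refine ⟨e * d, ⟨X * p, monic_X.mul hp, ?_⟩, by rw [map_mul, hψe, one_mul]⟩
  have key : ∀ q : A[X], e * q.eval₂ h (e * d) = e * q.eval₂ h d := fun q => by
    induction q using Polynomial.induction_on with
    | C a => simp
    | add p q hp hq => simp only [eval₂_add, mul_add, hp, hq]
    | monomial n a ih =>
      have hX (z : D) : (C a * X ^ (n + 1) : A[X]).eval₂ h z =
          (C a * X ^ n : A[X]).eval₂ h z * z := by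
        rw [pow_succ, ← mul_assoc, eval₂_mul, eval₂_X]
      rw [hX, hX]
      linear_combination e * d * ih + (C a * X ^ n : A[X]).eval₂ h d * d * he.eq
  rw [eval₂_mul, eval₂_X]
  linear_combination d * key p + d * hed

end RingHom

theorem IsPointwiseRealClosed.integralSubring {A : Type*} {D : Type u} [CommRing A] [CommRing D]
    (hA : IsVonNeumannRegular A) (hD : IsPointwiseRealClosed D) (h : A →+* D) :
    IsPointwiseRealClosed h.integralSubring where
  vnr := by
    have := (hD.real.of_injective (f := h.integralSubring.subtype) Subtype.val_injective).isReduced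
    exact hA.of_isIntegral RingHom.isIntegral_toIntegralSubring
  real := hD.real.of_injective (f := h.integralSubring.subtype) Subtype.val_injective
  decomp b := by
    obtain ⟨e, he, ⟨y, hy⟩, z, hz⟩ := hD.decomp b
    have hemem := RingHom.mem_integralSubring_of_isIdempotentElem (h := h) he
    have hymem : y ^ 2 ∈ h.integralSubring := hy ▸ mul_mem hemem b.2
    have hzmem : z ^ 2 ∈ h.integralSubring :=
      hz ▸ neg_mem (mul_mem (sub_mem (one_mem _) hemem) b.2)
    exact ⟨⟨e, hemem⟩, Subtype.ext he, ⟨⟨y, RingHom.mem_integralSubring_of_sq hymem⟩,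
      Subtype.ext hy⟩, ⟨z, RingHom.mem_integralSubring_of_sq hzmem⟩, Subtype.ext hz⟩
  root p hp hodd := by
    rcases subsingleton_or_nontrivial D with _ | _
    · exact ⟨0, Subtype.ext (Subsingleton.elim _ _)⟩
    obtain ⟨x, hx⟩ := hD.root (p.map h.integralSubring.subtype) (hp.map _) (by
      rwa [hp.natDegree_map])
    rw [Polynomial.eval_map] at hx
    have hmem : x ∈ h.integralSubring := RingHom.mem_integralSubring_of_isIntegralElem ⟨p, hp, hx⟩
    refine ⟨⟨x, hmem⟩, Subtype.ext ?_⟩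
    exact (Polynomial.eval₂_at_apply h.integralSubring.subtype ⟨x, hmem⟩).symm.trans hx

theorem IsPointwiseRealClosed.surjective_of_forall_isIdempotentElem {C C' : Type u} [CommRing C]
    [CommRing C'] (hC : IsPointwiseRealClosed C) (hC' : IsRealRing C') {f : C →+* C'}
    (hf : Function.Injective f) (hfi : f.IsIntegral)
    (hid : ∀ g, IsIdempotentElem g → ∃ u, f u = g) : Function.Surjective f := by
  have := hC'.isReduced
  have hvnr : IsVonNeumannRegular C' := hC.vnr.of_isIntegral hfi
  intro x
  let J : Ideal C :=
    { carrier := {c | ∃ d, f d = f c * x}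
      add_mem' := by
        rintro a b ⟨d, hd⟩ ⟨d', hd'⟩
        exact ⟨d + d', by rw [map_add, hd, hd', map_add, add_mul]⟩
      zero_mem' := ⟨0, by simp⟩
      smul_mem' := by
        rintro c a ⟨d, hd⟩
        exact ⟨c * d, by rw [map_mul, hd, smul_eq_mul, map_mul, mul_assoc]⟩ }
  by_cases hJ : J = ⊤
  · obtain ⟨d, hd⟩ : (1 : C) ∈ J := hJ ▸ Submodule.mem_top
    exact ⟨d, by rw [hd, map_one, one_mul]⟩
  exfalso
  obtain ⟨m, hm, hJm⟩ := Ideal.exists_le_maximal J hJ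
  obtain ⟨q, hq, hqm⟩ := hC.vnr.exists_comap_eq hf m
  obtain ⟨hfield, hrcf⟩ := hC.exists_isRealClosedField m
  let : Field (C ⧸ m) := hfield.toField
  let : Field (C' ⧸ q) :=
    ((Ideal.Quotient.maximal_ideal_iff_isField_quotient q).1 (hvnr.isMaximal q)).toField
  let φ : C ⧸ m →+* C' ⧸ q := Ideal.quotientMap q f hqm.ge
  have hφ : φ.IsIntegral := by
    refine RingHom.IsIntegral.tower_top (Ideal.Quotient.mk m) φ ?_
    have : φ.comp (Ideal.Quotient.mk m) = (Ideal.Quotient.mk q).comp f :=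
      Ideal.quotientMap_comp_mk _
    rw [this]
    exact hfi.trans _ _ (RingHom.isIntegral_of_surjective _ Ideal.Quotient.mk_surjective)
  obtain ⟨c, hc⟩ := hrcf.surjective_of_isIntegral (hC'.quotient hvnr q) φ hφ
    (Ideal.Quotient.mk q x)
  obtain ⟨c, rfl⟩ := Ideal.Quotient.mk_surjective c
  have hxc : x - f c ∈ q := Ideal.Quotient.eq.1 hc.symm
  obtain ⟨e, he, heq, hex⟩ := hvnr.exists_isIdempotentElem_notMem hq.ne_top hxc
  obtain ⟨e, rfl⟩ := hid e he
  refine heq (show e ∈ q.comap f from hqm ▸ hJm ⟨e * c, ?_⟩)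
  rw [map_mul]
  linear_combination -hex

/-- Every set of elements of the domain has a smallest idempotent support in the codomain. -/
def IsIdempotentComplete {A D : Type*} [CommRing A] [CommRing D] (h : A →+* D) : Prop :=
  ∀ S : Set A, ∃ u, IsIdempotentElem u ∧ (∀ s ∈ S, h s * u = h s) ∧
    ∀ a, (∀ s ∈ S, a * s = 0) → h a * u = 0

namespace IsIdempotentComplete

theorem toIntegralSubring {A D : Type*} [CommRing A] [CommRing D] {h : A →+* D}
    (hh : IsIdempotentComplete h) : IsIdempotentComplete h.toIntegralSubring := fun S => by
  obtain ⟨u, hu, h1, h2⟩ := hh S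
  exact ⟨⟨u, RingHom.mem_integralSubring_of_isIdempotentElem hu⟩, Subtype.ext hu,
    fun s hs => Subtype.ext (h1 s hs), fun a ha => Subtype.ext (h2 a ha)⟩

theorem pi {A ι : Type*} {K : ι → Type*} [CommRing A] [∀ i, Field (K i)] (κ : ∀ i, A →+* K i)
    (I : Ideal (∀ i, K i)) : IsIdempotentComplete ((Ideal.Quotient.mk I).comp (Pi.ringHom κ)) := by
  classical
  intro S
  let u : ∀ i, K i := fun i => if ∃ s ∈ S, κ i s ≠ 0 then 1 else 0
  refine ⟨Ideal.Quotient.mk I u, IsIdempotentElem.map (funext fun i => ?_) _, fun s hs => ?_,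
    fun a ha => ?_⟩
  · change u i * u i = u i
    dsimp only [u]
    split_ifs <;> simp
  · rw [RingHom.comp_apply, ← map_mul]
    refine congrArg _ (funext fun i => ?_)
    change κ i s * u i = κ i s
    by_cases h : κ i s = 0
    · rw [h, zero_mul]
    · rw [show u i = 1 from if_pos ⟨s, hs, h⟩, mul_one]
  · rw [RingHom.comp_apply, ← map_mul]
    refine (congrArg _ (funext fun i => ?_)).trans (map_zero _)
    change κ i a * u i = 0
    by_cases h : ∃ s ∈ S, κ i s ≠ 0
    · obtain ⟨s, hs, hs0⟩ := h
      have := congrArg (κ i) (ha s hs)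
      rw [map_mul, map_zero] at this
      rw [(mul_eq_zero.1 this).resolve_right hs0, zero_mul]
    · rw [show u i = 0 from if_neg h, mul_zero]

theorem exists_map_eq_of_isIdempotentElem {A C C' : Type*} [CommRing A] [CommRing C] [CommRing C']
    {i : A →+* C} (hi : IsIdempotentComplete i) {f : C →+* C'}
    (hk : IsEssentialExtension (f.comp i)) {g : C'} (hg : IsIdempotentElem g) :
    ∃ u, f u = g := by
  obtain ⟨u, hu, h1, h2⟩ := hi {s | f (i s) * g = f (i s)}
  have hu' : f u * f u = f u := by rw [← map_mul, hu.eq]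
  have hg' : g * g = g := hg
  have hug : (1 - f u) * g = 0 := by
    by_contra hne
    obtain ⟨a, y, hay, ha0⟩ := hk.exists_eq_mul hne
    rw [RingHom.comp_apply] at hay ha0
    have := congrArg f (h1 a (show f (i a) * g = f (i a) by
      linear_combination (g - 1) * hay + (1 - f u) * y * hg'))
    rw [map_mul] at this
    exact ha0 (by linear_combination -this + f u * hay - g * y * hu')
  have hgu : f u * (1 - g) = 0 := by
    by_contra hne
    obtain ⟨a, y, hay, ha0⟩ := hk.exists_eq_mul hne
    rw [RingHom.comp_apply] at hay ha0
    have := congrArg f (h2 a fun s hs => hk.1 (by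
      rw [map_zero, RingHom.comp_apply, map_mul, map_mul]
      have hs' : f (i s) * g = f (i s) := hs
      linear_combination f (i s) * hay - f u * y * hs'))
    rw [map_mul, map_zero] at this
    exact ha0 (by linear_combination this + (1 - f u) * hay - (1 - g) * y * hu')
  exact ⟨u, by linear_combination hgu - hug⟩

end IsIdempotentComplete

theorem IsEssentialExtension.toIntegralSubring {A D : Type*} [CommRing A] [CommRing D]
    {h : A →+* D} (hess : IsEssentialExtension h) (hC : IsVonNeumannRegular h.integralSubring) :
    IsEssentialExtension h.toIntegralSubring := by
  refine ⟨fun a b hab => hess.1 (congrArg Subtype.val hab), fun J hJ => ?_⟩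
  obtain ⟨c, hc, hc0⟩ := J.ne_bot_iff.1 hJ
  obtain ⟨b, hb, hcb⟩ := hC.exists_mul_isIdempotentElem c
  have hne : ((c * b : h.integralSubring) : D) ≠ 0 := fun h0 => hc0 (by
    rw [← hcb, show c * b = 0 from Subtype.ext h0, zero_mul])
  obtain ⟨a, y, hay, ha0⟩ := hess.exists_eq_mul hne
  refine ⟨a, ?_, fun h0 => ha0 (congrArg Subtype.val h0)⟩
  have : h.toIntegralSubring a = c * (b * h.toIntegralSubring a) := by
    apply Subtype.ext
    have hb' : ((c * b : h.integralSubring) : D) * (c * b : h.integralSubring) =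
      (c * b : h.integralSubring) := congrArg Subtype.val hb
    change h a = c * (b * h a)
    rw [Subring.coe_mul] at hb' hay
    linear_combination (1 - (c : D) * b) * hay - y * hb'
  rw [this]
  exact J.mul_mem_right _ hc

/-- The integral closure of a von Neumann regular poring in an essential extension which is
pointwise real closed and contains the supports of subsets of `A` is a real closure. -/
theorem IsPointwiseRealClosed.isRealClosureStarOf {A : Type u} [CommRing A]
    (hA : IsVonNeumannRegular A) {P : Set A} {D : Type u} [CommRing D]
    (hD : IsPointwiseRealClosed D) {h : A →+* D} (hh : IsIdempotentComplete h)
    (hess : IsEssentialExtension h) (hP : ∀ a ∈ P, ∃ y, y ^ 2 = h a) :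
    IsRealClosureStarOf A P h.integralSubring {b | ∃ y, y ^ 2 = b} h.toIntegralSubring := by
  have hC := hD.integralSubring hA h
  have hess' := hess.toIntegralSubring hC.vnr
  refine ⟨hC.isPartialOrdering_squares, ⟨hC.real, fun C' _ f hC' hf hfi => ?_⟩, hess',
    RingHom.isIntegral_toIntegralSubring, fun a ha => ?_⟩
  · exact hC.surjective_of_forall_isIdempotentElem hC' hf.1 hfi fun g hg =>
      hh.toIntegralSubring.exists_map_eq_of_isIdempotentElem (hf.comp hess') hg
  · obtain ⟨y, hy⟩ := hP a ha
    exact ⟨⟨y, RingHom.mem_integralSubring_of_sq (hy ▸ h.isIntegralElem_map)⟩, Subtype.ext hy⟩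

theorem IsPointwiseRealClosed.mem_iff_exists_sq_sub_mem {C : Type u} [CommRing C]
    (hC : IsPointwiseRealClosed C) (q : Ideal C) [q.IsPrime] (x : C) :
    x ∈ q ↔ (∃ y, y ^ 2 - x ∈ q) ∧ ∃ y, y ^ 2 - -x ∈ q := by
  constructor
  · intro hx
    exact ⟨⟨0, by simpa using hx⟩, 0, by simpa using hx⟩
  · rintro ⟨⟨y, hy⟩, z, hz⟩
    have hyq : Ideal.Quotient.mk q y = 0 :=
      (IsRealClosedField.sq_add_sq_eq_zero (hC.real.quotient hC.vnr q)
        (y := Ideal.Quotient.mk q z) (by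
          rw [← map_pow, ← map_pow, ← map_add, Ideal.Quotient.eq_zero_iff_mem]
          convert q.add_mem hy hz using 1
          ring)).1
    convert q.sub_mem (q.mul_mem_left y (Ideal.Quotient.eq_zero_iff_mem.1 hyq)) hy using 1
    ring

/-- A prime cone of `A` is induced by `f : A →+* C` if it is the preimage of the squares of some
residue ring of `C`. -/
def PrimeCone.IsInducedBy {A C : Type u} [CommRing A] [CommRing C] (α : PrimeCone A)
    (f : A →+* C) : Prop :=
  ∃ q : Ideal C, q.IsPrime ∧ ∀ a, a ∈ α.carrier ↔ ∃ y, y ^ 2 - f a ∈ q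

namespace PrimeCone

theorem IsInducedBy.of_ringEquiv {A C C' : Type u} [CommRing A] [CommRing C] [CommRing C']
    {α : PrimeCone A} {f : A →+* C} {f' : A →+* C'} (ε : C ≃+* C') (hε : ∀ a, ε (f a) = f' a)
    (hα : α.IsInducedBy f) : α.IsInducedBy f' := by
  obtain ⟨q, hq, h⟩ := hα
  refine ⟨q.comap ε.symm.toRingHom, inferInstance, fun a => (h a).trans ⟨?_, ?_⟩⟩
  · rintro ⟨y, hy⟩
    refine ⟨ε y, ?_⟩
    change ε.symm (ε y ^ 2 - f' a) ∈ q
    rwa [← hε, ← map_pow, ← map_sub, ε.symm_apply_apply]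
  · rintro ⟨y, hy⟩
    refine ⟨ε.symm y, ?_⟩
    have hy' : ε.symm (y ^ 2 - f' a) ∈ q := hy
    rwa [← hε, map_sub, map_pow, ε.symm_apply_apply] at hy'

theorem isInducedBy_iff_of_ringEquiv {A C C' : Type u} [CommRing A] [CommRing C] [CommRing C']
    {α : PrimeCone A} {f : A →+* C} {f' : A →+* C'} (ε : C ≃+* C') (hε : ∀ a, ε (f a) = f' a) :
    α.IsInducedBy f ↔ α.IsInducedBy f' :=
  ⟨.of_ringEquiv ε hε, .of_ringEquiv ε.symm fun a => by rw [← hε, ε.symm_apply_apply]⟩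

/-- The prime cones singled out by a quotient `B ⧸ I` are those induced by the integral closure
in `B ⧸ I`. -/
theorem exists_rhoIsoIntegralClosure_iff {A B : Type u} [CommRing A] [CommRing B]
    (hA : IsVonNeumannRegular A) (hB : IsPointwiseRealClosed B) (κ : A →+* B) (I : Ideal B)
    (α : PrimeCone A) :
    (∃ 𝔭 : Ideal B, 𝔭.IsPrime ∧ I ≤ 𝔭 ∧ Ideal.map κ α.support ≤ 𝔭 ∧
      Nonempty (RhoIsoIntegralClosure A α (B ⧸ 𝔭) ((Ideal.Quotient.mk 𝔭).comp κ))) ↔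
    α.IsInducedBy ((Ideal.Quotient.mk I).comp κ).toIntegralSubring := by
  set h := (Ideal.Quotient.mk I).comp κ with hh
  have hD := hB.quotient I
  constructor
  · rintro ⟨𝔭, hp, hI, -, ⟨⟨F, j, rcf, ord, alg, e, comm, range_ic⟩⟩⟩
    let ψ : B ⧸ I →+* B ⧸ 𝔭 := Ideal.Quotient.factor hI
    have hψ : Function.Surjective ψ := Ideal.Quotient.factor_surjective hI
    have hψh : ψ.comp h = (Ideal.Quotient.mk 𝔭).comp κ := RingHom.ext fun _ => rfl
    refine ⟨RingHom.ker (ψ.comp h.integralSubring.subtype), RingHom.ker_isPrime _, fun a => ?_⟩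
    rw [← ord]
    constructor
    · rintro ⟨y, hy⟩
      have hey : e y ∈ Set.range e := ⟨y, rfl⟩
      rw [range_ic, Set.mem_ofPred_eq, ← hψh] at hey
      obtain ⟨c, hc, hcy⟩ := RingHom.exists_mem_integralSubring_eq hD.vnr hψ hey
      refine ⟨⟨c, hc⟩, ?_⟩
      change ψ (c ^ 2 - h a) = 0
      have ha : ψ (h a) = e (j a) := (comm a).symm
      rw [map_sub, map_pow, hcy, ha, ← hy, map_pow, sub_self]
    · rintro ⟨c, hc⟩
      have hc' : ψ ((c : B ⧸ I) ^ 2 - h a) = 0 := hc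
      have hmem : ψ c ∈ Set.range e := by
        rw [range_ic, Set.mem_ofPred_eq, ← hψh]
        obtain ⟨p, hp, hpc⟩ := c.2
        exact ⟨p, hp, by rw [← Polynomial.hom_eval₂, hpc, map_zero]⟩
      obtain ⟨y, hy⟩ := hmem
      refine ⟨y, e.injective ?_⟩
      rw [map_sub, map_pow, ← hy, sub_eq_zero] at hc'
      rw [map_pow, hc', comm]
      rfl
  · rintro ⟨q, hq, hα⟩
    have hC := hD.integralSubring hA h
    obtain ⟨p, hp, hpq⟩ := hC.vnr.exists_comap_eq (f := h.integralSubring.subtype)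
      Subtype.val_injective q
    have hI : I ≤ p.comap (Ideal.Quotient.mk I) := fun b hb => by
      rw [Ideal.mem_comap, Ideal.Quotient.eq_zero_iff_mem.2 hb]
      exact p.zero_mem
    have hpc : (p.comap (Ideal.Quotient.mk I)).IsPrime := inferInstance
    obtain ⟨hfield, hrcf⟩ := hC.exists_isRealClosedField q
    let ψ : B ⧸ I →+* B ⧸ p.comap (Ideal.Quotient.mk I) := Ideal.Quotient.factor hI
    have hψ : Function.Surjective ψ := Ideal.Quotient.factor_surjective hI
    have hψ0 : ∀ x ∈ p, ψ x = 0 := fun x hx => by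
      obtain ⟨b, rfl⟩ := Ideal.Quotient.mk_surjective x
      exact Ideal.Quotient.eq_zero_iff_mem.2 hx
    have hψq : ∀ c ∈ q, ψ.comp h.integralSubring.subtype c = 0 := fun c hc =>
      hψ0 _ (by rw [← hpq] at hc; exact hc)
    refine ⟨p.comap (Ideal.Quotient.mk I), hpc, hI, ?_, ⟨?_⟩⟩
    · rw [Ideal.map_le_iff_le_comap]
      intro a ha
      obtain ⟨ha1, ha2⟩ := (α.mem_support a).1 ha
      have haq : h.toIntegralSubring a ∈ q :=
        (hC.mem_iff_exists_sq_sub_mem q _).2 ⟨(hα _).1 ha1,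
          map_neg h.toIntegralSubring a ▸ (hα _).1 ha2⟩
      rw [← hpq] at haq
      exact haq
    · let : Field (h.integralSubring ⧸ q) := hfield.toField
      refine
        { F := h.integralSubring ⧸ q
          j := (Ideal.Quotient.mk q).comp h.toIntegralSubring
          rcf := hrcf
          ord := fun a => ?_
          alg := fun x => ?_
          e := Ideal.Quotient.lift q (ψ.comp h.integralSubring.subtype) hψq
          comm := fun a => rfl
          range_ic := ?_ }
      · rw [hα a]
        constructor
        · rintro ⟨y, hy⟩
          obtain ⟨y, rfl⟩ := Ideal.Quotient.mk_surjective y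
          exact ⟨y, Ideal.Quotient.eq.1 hy⟩
        · rintro ⟨y, hy⟩
          exact ⟨Ideal.Quotient.mk q y, Ideal.Quotient.eq.2 hy⟩
      · obtain ⟨x, rfl⟩ := Ideal.Quotient.mk_surjective x
        obtain ⟨r, hr, hrx⟩ := RingHom.isIntegral_toIntegralSubring (h := h) x
        refine ⟨r, ?_, (hr.map _).ne_zero⟩
        exact (Polynomial.hom_eval₂ r _ _ _).symm.trans (by rw [hrx, map_zero])
      · ext x
        constructor
        · rintro ⟨c, rfl⟩
          obtain ⟨c, rfl⟩ := Ideal.Quotient.mk_surjective c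
          obtain ⟨r, hr, hrc⟩ := c.2
          exact ⟨r, hr, (Polynomial.hom_eval₂ r h ψ c).symm.trans (by rw [hrc, map_zero])⟩
        · intro hx
          obtain ⟨c, hc, rfl⟩ := RingHom.exists_mem_integralSubring_eq (h := h) hD.vnr hψ hx
          exact ⟨Ideal.Quotient.mk q ⟨c, hc⟩, rfl⟩

end PrimeCone

/-- A real closed ring mapping to a hull of `A` over `A` is the integral closure in that hull. -/
theorem IsPointwiseRealClosed.exists_ringEquiv_integralSubring {A C D : Type u} [CommRing A]
    [CommRing C] [CommRing D] (hA : IsVonNeumannRegular A) (hD : IsPointwiseRealClosed D)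
    {h : A →+* D} (hess : IsEssentialExtension h) (hC : IsRealClosedStar C) {f : A →+* C}
    (hf : IsEssentialExtension f) (hfi : f.IsIntegral) {G : C →+* D} (hG : ∀ a, G (f a) = h a) :
    ∃ ε : C ≃+* h.integralSubring, ∀ a, ε (f a) = h.toIntegralSubring a := by
  have hGinj : Function.Injective G := by
    rw [RingHom.injective_iff_ker_eq_bot]
    by_contra hne
    obtain ⟨a, ha, ha0⟩ := hf.2 _ hne
    rw [RingHom.mem_ker, hG] at ha
    exact ha0 (by rw [hess.1 (ha.trans (map_zero h).symm), map_zero])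
  have hmem : ∀ c, G c ∈ h.integralSubring := fun c => by
    obtain ⟨p, hp, hpc⟩ := hfi c
    refine ⟨p, hp, ?_⟩
    rw [← (RingHom.ext hG : G.comp f = h), ← Polynomial.hom_eval₂, hpc, map_zero]
  let G' : C →+* h.integralSubring := G.codRestrict _ hmem
  have hG' : G'.comp f = h.toIntegralSubring := RingHom.ext fun a => Subtype.ext (hG a)
  have hIC := hD.integralSubring hA h
  have hinj : Function.Injective G' := fun x y hxy => hGinj (congrArg Subtype.val hxy)
  have hsurj : Function.Surjective G' := by
    refine hC.2 _ G' hIC.real ⟨hinj, fun J hJ => ?_⟩ (RingHom.IsIntegral.tower_top f G' ?_)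
    · obtain ⟨a, ha, ha0⟩ := (hess.toIntegralSubring hIC.vnr).2 J hJ
      rw [← hG'] at ha ha0
      exact ⟨f a, ha, ha0⟩
    · rw [hG']
      exact RingHom.isIntegral_toIntegralSubring
  exact ⟨RingEquiv.ofBijective G' ⟨hinj, hsurj⟩, fun a => RingHom.congr_fun hG' a⟩

/-- Every residue field of a von Neumann regular poring has an algebraic real closed extension in
which the positive elements become squares. -/
theorem IsPartialOrdering.exists_isRealClosedField {C : Type u} [CommRing C] {Q : Set C}
    (hQ : IsPartialOrdering Q) (hC : IsVonNeumannRegular C) (q : Ideal C) [hq : q.IsPrime] :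
    ∃ (L : Type u) (_ : Field L) (g : C →+* L), g.IsIntegral ∧ IsRealClosedField L ∧
      RingHom.ker g = q ∧ ∀ b ∈ Q, ∃ y, y ^ 2 = g b := by
  obtain ⟨hadd, hmul, hsq, hneg⟩ := hQ
  let : Field (C ⧸ q) :=
    ((Ideal.Quotient.maximal_ideal_iff_isField_quotient q).1 (hC.isMaximal q)).toField
  let T : Subsemiring C :=
    { carrier := Q
      mul_mem' := fun {a b} ha hb => hmul a ha b hb
      one_mem' := by simpa using hsq 1
      add_mem' := fun {a b} ha hb => hadd a ha b hb
      zero_mem' := by simpa using hsq 0 }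
  obtain ⟨L, _, φ, hφ, hL, hT⟩ := IsRealClosedField.exists_of_preordering
    (i := algebraMap (C ⧸ q) (AlgebraicClosure (C ⧸ q)))
    (algebraMap_isIntegral_iff.2 inferInstance) (T.map (Ideal.Quotient.mk q)) (fun x => by
      obtain ⟨x, rfl⟩ := Ideal.Quotient.mk_surjective x
      exact ⟨x ^ 2, hsq x, map_pow _ _ _⟩) (by
      rintro ⟨b, hb, hb1⟩
      have hb1q : b + 1 ∈ q := by
        rw [← Ideal.Quotient.eq_zero_iff_mem, map_add, map_one]
        exact add_eq_zero_iff_eq_neg.2 hb1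
      obtain ⟨e, he, heq, heb⟩ := hC.exists_isIdempotentElem_notMem hq.ne_top hb1q
      have heQ : e ∈ Q := by
        rw [← he.eq, ← pow_two]
        exact hsq e
      refine heq (hneg e heQ ?_ ▸ q.zero_mem)
      rw [show -e = e * b by linear_combination -heb]
      exact hmul e heQ b hb)
  refine ⟨L, _, φ.comp (Ideal.Quotient.mk q), ?_, hL, ?_, fun b hb => hT _ ⟨b, hb, rfl⟩⟩
  · exact (RingHom.isIntegral_of_surjective _ Ideal.Quotient.mk_surjective).trans _ _ hφ
  · ext x
    rw [RingHom.mem_ker, RingHom.comp_apply, map_eq_zero_iff φ φ.injective,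
      Ideal.Quotient.eq_zero_iff_mem]

theorem RingHom.IsIntegral.exists_eval₂_eq_zero {A L : Type*} [CommRing A] [Field L] {κ : A →+* L}
    (hκ : κ.IsIntegral) (x : L) : ∃ q : Polynomial A, q.eval₂ κ x = 0 ∧ q.map κ ≠ 0 := by
  obtain ⟨r, hr, hrx⟩ := hκ x
  exact ⟨r, hrx, (hr.map κ).ne_zero⟩

/-- Every integral extension of porings can be embedded into an extension by real closed
fields. -/
theorem IsPartialOrdering.exists_isEpof {A C : Type u} [CommRing A] [CommRing C]
    (hA : IsVonNeumannRegular A) (hC : IsRealRing C) {f : A →+* C} (hf : Function.Injective f)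
    (hfi : f.IsIntegral) {P : Set A} {Q : Set C} (hQ : IsPartialOrdering Q)
    (hPQ : ∀ a ∈ P, f a ∈ Q) :
    ∃ (K : PrimeSpectrum A → Type u) (_ : ∀ p, Field (K p)) (κ : ∀ p, A →+* K p),
      IsEpof A P K κ ∧ ∃ g : ∀ p, C →+* K p, ∀ p a, g p (f a) = κ p a := by
  have := hC.isReduced
  have hvnr := hA.of_isIntegral hfi
  have key : ∀ p : PrimeSpectrum A, ∃ (L : Type u) (_ : Field L) (g : C →+* L), g.IsIntegral ∧
      IsRealClosedField L ∧ (∀ a, g (f a) = 0 ↔ a ∈ p.asIdeal) ∧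
      ∀ b ∈ Q, ∃ y, y ^ 2 = g b := fun p => by
    obtain ⟨q, hq, hqp⟩ := hA.exists_comap_eq hf p.asIdeal
    obtain ⟨L, _, g, hg, hL, hker, hsq⟩ := hQ.exists_isRealClosedField hvnr q
    refine ⟨L, _, g, hg, hL, fun a => ?_, hsq⟩
    rw [← RingHom.mem_ker, hker, ← hqp, Ideal.mem_comap]
  choose K _ g hg hK hker hsq using key
  exact ⟨K, _, fun p => (g p).comp f, ⟨hker, hK,
    fun p => (hfi.trans _ _ (hg p)).exists_eval₂_eq_zero, fun p a ha => hsq p _ (hPQ a ha)⟩,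
    g, fun _ _ => rfl⟩

theorem IsEpof.injective {A : Type u} [CommRing A] [IsReduced A] {P : Set A}
    {K : PrimeSpectrum A → Type u} [∀ p, Field (K p)] {κ : ∀ p, A →+* K p}
    (h : IsEpof A P K κ) : Function.Injective (Pi.ringHom κ) := by
  rw [injective_iff_map_eq_zero]
  intro a ha
  have : a ∈ nilradical A := by
    rw [nilradical_eq_sInf, Ideal.mem_sInf]
    intro p hp
    exact (h.ker ⟨p, hp⟩ a).1 (congrFun ha _)
  rwa [nilradical_eq_zero, Ideal.zero_eq_bot, Ideal.mem_bot] at this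

/-- The prime cone of `A` obtained from a residue field of a pointwise real closed ring. -/
def IsPointwiseRealClosed.primeCone {A C : Type u} [CommRing A] [CommRing C]
    (hC : IsPointwiseRealClosed C) (f : A →+* C) (q : Ideal C) [hq : q.IsPrime] : PrimeCone A where
  carrier := {a | ∃ y, y ^ 2 - f a ∈ q}
  add_mem := by
    rintro a ⟨y, hy⟩ b ⟨z, hz⟩
    obtain ⟨w, hw⟩ := hC.exists_sq_eq_add y z
    refine ⟨w, ?_⟩
    rw [hw, map_add]
    convert q.add_mem hy hz using 1
    ring
  mul_mem := by
    rintro a ⟨y, hy⟩ b ⟨z, hz⟩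
    refine ⟨y * z, ?_⟩
    rw [map_mul]
    convert q.add_mem (q.mul_mem_left (z ^ 2) hy) (q.mul_mem_left (f a) hz) using 1
    ring
  sq_mem a := ⟨f a, by simp⟩
  mem_or_neg_mem a := by
    obtain ⟨hfield, hrcf⟩ := hC.exists_isRealClosedField q
    let : Field (C ⧸ q) := hfield.toField
    rcases hrcf.2.1 (Ideal.Quotient.mk q (f a)) with ⟨y, hy⟩ | ⟨y, hy⟩
    · obtain ⟨y, rfl⟩ := Ideal.Quotient.mk_surjective y
      exact .inl ⟨y, Ideal.Quotient.eq.1 hy⟩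
    · obtain ⟨y, rfl⟩ := Ideal.Quotient.mk_surjective y
      exact .inr ⟨y, Ideal.Quotient.eq.1 (hy.trans (by rw [map_neg, map_neg]))⟩
  support := q.comap f
  mem_support a := by
    rw [Ideal.mem_comap, hC.mem_iff_exists_sq_sub_mem q, ← map_neg]
    rfl
  support_isPrime := inferInstance

/-- Two pointwise real closed integral extensions of `A` that induce the same prime cones can be
embedded into a common extension by real closed fields. -/
theorem IsPointwiseRealClosed.exists_isEpof {A C₁ C₂ : Type u} [CommRing A] [CommRing C₁]
    [CommRing C₂] (hA : IsVonNeumannRegular A) (h₁ : IsPointwiseRealClosed C₁)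
    (h₂ : IsPointwiseRealClosed C₂) {f₁ : A →+* C₁} {f₂ : A →+* C₂} (hf₁ : Function.Injective f₁)
    (hfi₁ : f₁.IsIntegral) (hfi₂ : f₂.IsIntegral) {P : Set A} (hP₁ : ∀ a ∈ P, ∃ y, y ^ 2 = f₁ a)
    (hind : ∀ α : PrimeCone A, P ⊆ α.carrier → α.IsInducedBy f₁ → α.IsInducedBy f₂) :
    ∃ (K : PrimeSpectrum A → Type u) (_ : ∀ p, Field (K p)) (κ : ∀ p, A →+* K p),
      IsEpof A P K κ ∧ (∃ g : ∀ p, C₁ →+* K p, ∀ p a, g p (f₁ a) = κ p a) ∧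
        ∃ g : ∀ p, C₂ →+* K p, ∀ p a, g p (f₂ a) = κ p a := by
  have key : ∀ p : PrimeSpectrum A, ∃ (L : Type u) (_ : Field L) (κ : A →+* L),
      (∀ a, κ a = 0 ↔ a ∈ p.asIdeal) ∧ IsRealClosedField L ∧ κ.IsIntegral ∧
      (∀ a ∈ P, ∃ y, y ^ 2 = κ a) ∧ (∃ g : C₁ →+* L, ∀ a, g (f₁ a) = κ a) ∧
        ∃ g : C₂ →+* L, ∀ a, g (f₂ a) = κ a := fun p => by
    obtain ⟨q₁, hq₁, hqp⟩ := hA.exists_comap_eq hf₁ p.asIdeal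
    let α := h₁.primeCone f₁ q₁
    obtain ⟨q₂, hq₂, hα⟩ := hind α (fun a ha => by
      obtain ⟨y, hy⟩ := hP₁ a ha
      exact ⟨y, by simp [hy]⟩) ⟨q₁, hq₁, fun _ => Iff.rfl⟩
    obtain ⟨hfield₁, hrcf₁⟩ := h₁.exists_isRealClosedField q₁
    obtain ⟨hfield₂, hrcf₂⟩ := h₂.exists_isRealClosedField q₂
    let : Field (C₁ ⧸ q₁) := hfield₁.toField
    let : Field (C₂ ⧸ q₂) := hfield₂.toField
    have hi₁ : ((Ideal.Quotient.mk q₁).comp f₁).IsIntegral :=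
      hfi₁.trans _ _ (RingHom.isIntegral_of_surjective _ Ideal.Quotient.mk_surjective)
    have hi₂ : ((Ideal.Quotient.mk q₂).comp f₂).IsIntegral :=
      hfi₂.trans _ _ (RingHom.isIntegral_of_surjective _ Ideal.Quotient.mk_surjective)
    have hsq {C : Type u} [CommRing C] (q : Ideal C) (x : C) :
        (∃ y : C ⧸ q, y ^ 2 = Ideal.Quotient.mk q x) ↔ ∃ y, y ^ 2 - x ∈ q := by
      rw [Ideal.Quotient.mk_surjective.exists]
      exact exists_congr fun y => Ideal.Quotient.eq
    have hα₂ (a : A) : (∃ y : C₁ ⧸ q₁, y ^ 2 = Ideal.Quotient.mk q₁ (f₁ a)) ↔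
        ∃ y : C₂ ⧸ q₂, y ^ 2 = Ideal.Quotient.mk q₂ (f₂ a) :=
      (hsq q₁ _).trans ((hα a).trans (hsq q₂ _).symm)
    obtain ⟨φ, hφ⟩ := IsRealClosedField.exists_ringHom_comp_eq hA hrcf₁ hrcf₂ hi₁ hi₂ hα₂
    refine ⟨C₂ ⧸ q₂, _, (Ideal.Quotient.mk q₂).comp f₂, fun a => ?_, hrcf₂, hi₂, fun a ha => ?_,
      ⟨φ.comp (Ideal.Quotient.mk q₁), RingHom.congr_fun hφ⟩, Ideal.Quotient.mk q₂, fun _ => rfl⟩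
    · rw [← hφ, RingHom.comp_apply, map_eq_zero_iff φ φ.injective, RingHom.comp_apply,
        Ideal.Quotient.eq_zero_iff_mem, ← hqp, Ideal.mem_comap]
    · obtain ⟨y, hy⟩ := hP₁ a ha
      exact (hα₂ a).1 ⟨Ideal.Quotient.mk q₁ y, by rw [← map_pow, hy]⟩
  choose K _ κ hker hK hκ hP hg₁ hg₂ using key
  choose g₁ hg₁ using hg₁
  choose g₂ hg₂ using hg₂
  exact ⟨K, _, κ, ⟨hker, hK, fun p => (hκ p).exists_eval₂_eq_zero, hP⟩, ⟨g₁, hg₁⟩, g₂, hg₂⟩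

namespace IsEpof

variable {A : Type u} [CommRing A] {P : Set A} {K : PrimeSpectrum A → Type u} [∀ p, Field (K p)]
  {κ : ∀ p, A →+* K p} {I : Ideal (∀ p, K p)}

theorem isRealClosureStarOf (h : IsEpof A P K κ) (hA : IsVonNeumannRegular A)
    (hI : IsEssentialExtension ((Ideal.Quotient.mk I).comp (Pi.ringHom κ))) :
    IsRealClosureStarOf A P ((Ideal.Quotient.mk I).comp (Pi.ringHom κ)).integralSubring
      {b | ∃ y, y ^ 2 = b} ((Ideal.Quotient.mk I).comp (Pi.ringHom κ)).toIntegralSubring :=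
  ((IsPointwiseRealClosed.pi h.rcf).quotient I).isRealClosureStarOf hA (.pi κ I) hI fun a ha => by
    choose y hy using fun p => h.ordext p a ha
    exact ⟨Ideal.Quotient.mk I y, (map_pow _ _ _).symm.trans (congrArg _ (funext hy))⟩

theorem exists_ringEquiv (h : IsEpof A P K κ) (hA : IsVonNeumannRegular A)
    (hI : IsEssentialExtension ((Ideal.Quotient.mk I).comp (Pi.ringHom κ)))
    {C : Type u} [CommRing C] {Q : Set C} {f : A →+* C} (hC : IsRealClosureStarOf A P C Q f)
    (g : ∀ p, C →+* K p) (hg : ∀ p a, g p (f a) = κ p a) :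
    ∃ ε : C ≃+* ((Ideal.Quotient.mk I).comp (Pi.ringHom κ)).integralSubring,
      ∀ a, ε (f a) = ((Ideal.Quotient.mk I).comp (Pi.ringHom κ)).toIntegralSubring a :=
  ((IsPointwiseRealClosed.pi h.rcf).quotient I).exists_ringEquiv_integralSubring hA hI hC.rcs
    hC.essential hC.integral (G := (Ideal.Quotient.mk I).comp (Pi.ringHom g))
    fun a => congrArg (Ideal.Quotient.mk I) (funext fun p => hg p a)

end IsEpof

/-- Every real closure of a real von Neumann regular poring is an integral closure in a quotient
of an extension by a product of real closed fields. -/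
theorem IsRealClosureStarOf.exists_isEpof {A : Type u} [CommRing A] {P : Set A}
    (hreal : IsRealRing A) (hA : IsVonNeumannRegular A) {C : Type u} [CommRing C] {Q : Set C}
    {f : A →+* C} (hC : IsRealClosureStarOf A P C Q f) :
    ∃ (K : PrimeSpectrum A → Type u) (_ : ∀ p, Field (K p)) (κ : ∀ p, A →+* K p)
      (I : Ideal (∀ p, K p)), IsEpof A P K κ ∧
      IsEssentialExtension ((Ideal.Quotient.mk I).comp (Pi.ringHom κ)) ∧
      ∃ ε : C ≃+* ((Ideal.Quotient.mk I).comp (Pi.ringHom κ)).integralSubring,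
        ∀ a, ε (f a) = ((Ideal.Quotient.mk I).comp (Pi.ringHom κ)).toIntegralSubring a := by
  have := hreal.isReduced
  obtain ⟨K, _, κ, hK, g, hg⟩ := hC.pos_partial.exists_isEpof hA hC.rcs.1 hC.essential.1
    hC.integral hC.mono
  obtain ⟨I, hI⟩ := exists_isEssentialExtension_quotient hK.injective
  exact ⟨K, _, κ, I, hK, hI, hK.exists_ringEquiv hA hI hC g hg⟩

theorem IsRealClosureStarOf.isPointwiseRealClosed {A : Type u} [CommRing A] {P : Set A}
    (hreal : IsRealRing A) (hA : IsVonNeumannRegular A) {C : Type u} [CommRing C] {Q : Set C}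
    {f : A →+* C} (hC : IsRealClosureStarOf A P C Q f) : IsPointwiseRealClosed C := by
  obtain ⟨K, _, κ, I, hK, -, ε, -⟩ := hC.exists_isEpof hreal hA
  exact (((IsPointwiseRealClosed.pi hK.rcf).quotient I).integralSubring hA _).of_ringEquiv ε.symm

/-- Statement 8 without the Baer hypothesis: a real von Neumann regular
poring `(A, P)` has a unique real closure * iff there is a subset `X ⊆ Sper A` such that
for every epof `B` of `A` and every ideal `I` of `B` making `A → B → B / I` an essential
extension of `A`, `X` is the set of those `α ∈ Sper A` for which `ρ(α)` is
`A / supp α`-isomorphic to the integral closure of `A / supp α` in `B / 𝔭` for some prime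
`𝔭` of `B` containing `I` and the ideal generated by `supp α`. -/
theorem hasUniqueRealClosureStar_iff
    (A : Type u) [CommRing A] (P : Set A) (hP : IsPartialOrdering P)
    (hreal : IsRealRing A) (hvnr : IsVonNeumannRegular A) :
    HasUniqueRealClosureStar A P ↔
      ∃ X : Set (RealSpectrum A P),
        ∀ (K : PrimeSpectrum A → Type u) [∀ p, Field (K p)] (κ : ∀ p, A →+* K p),
          IsEpof A P K κ →
          ∀ I : Ideal (∀ p, K p),
            IsEssentialExtension ((Ideal.Quotient.mk I).comp (Pi.ringHom κ)) →
            X = {α : RealSpectrum A P |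
              ∃ 𝔭 : Ideal (∀ p, K p), 𝔭.IsPrime ∧ I ≤ 𝔭 ∧
                Ideal.map (Pi.ringHom κ) α.1.support ≤ 𝔭 ∧
                Nonempty (RhoIsoIntegralClosure A α.1 ((∀ p, K p) ⧸ 𝔭)
                  ((Ideal.Quotient.mk 𝔭).comp (Pi.ringHom κ)))} := by
  constructor
  · rintro ⟨⟨C⟩, huniq⟩
    refine ⟨{α | α.1.IsInducedBy C.emb}, fun K _ κ hK I hI => Set.ext fun α => ?_⟩
    obtain ⟨ε, hε, -⟩ := huniq C ⟨_, _, _, hK.isRealClosureStarOf hvnr hI⟩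
    exact (PrimeCone.isInducedBy_iff_of_ringEquiv ε hε).trans
      (PrimeCone.exists_rhoIsoIntegralClosure_iff hvnr (.pi hK.rcf) _ I α.1).symm
  · rintro ⟨X, hX⟩
    have := hreal.isReduced
    have hind (C : RealClosureStar A P) (α : PrimeCone A) (hα : P ⊆ α.carrier) :
        α.IsInducedBy C.emb ↔ (⟨α, hα⟩ : RealSpectrum A P) ∈ X := by
      obtain ⟨K, _, κ, I, hK, hI, ε, hε⟩ := C.is.exists_isEpof hreal hvnr
      rw [PrimeCone.isInducedBy_iff_of_ringEquiv ε hε, hX K κ hK I hI]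
      exact (PrimeCone.exists_rhoIsoIntegralClosure_iff hvnr (.pi hK.rcf) _ I α).symm
    refine ⟨?_, fun C₁ C₂ => ?_⟩
    · obtain ⟨K, _, κ, hK, -⟩ := hP.exists_isEpof (f := RingHom.id A) hvnr hreal
        Function.injective_id (RingHom.isIntegral_of_surjective _ Function.surjective_id)
        fun _ ha => ha
      obtain ⟨I, hI⟩ := exists_isEssentialExtension_quotient hK.injective
      exact ⟨⟨_, _, _, hK.isRealClosureStarOf hvnr hI⟩⟩
    · have h₁ := C₁.is.isPointwiseRealClosed hreal hvnr
      have h₂ := C₂.is.isPointwiseRealClosed hreal hvnr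
      obtain ⟨K, _, κ, hK, ⟨g₁, hg₁⟩, g₂, hg₂⟩ := h₁.exists_isEpof hvnr h₂ C₁.is.essential.1
        C₁.is.integral C₂.is.integral
        (fun a ha => (h₁.mem_iff_exists_sq C₁.is.pos_partial _).1 (C₁.is.mono a ha))
        fun α hα h => (hind C₂ α hα).2 ((hind C₁ α hα).1 h)
      obtain ⟨I, hI⟩ := exists_isEssentialExtension_quotient hK.injective
      obtain ⟨ε₁, hε₁⟩ := hK.exists_ringEquiv hvnr hI C₁.is g₁ hg₁
      obtain ⟨ε₂, hε₂⟩ := hK.exists_ringEquiv hvnr hI C₂.is g₂ hg₂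
      refine ⟨ε₁.trans ε₂.symm, fun a => ?_, fun b => ?_⟩
      · rw [RingEquiv.trans_apply, hε₁, ← hε₂, ε₂.symm_apply_apply]
      · rw [h₁.mem_iff_exists_sq C₁.is.pos_partial, h₂.mem_iff_exists_sq C₂.is.pos_partial,
          (ε₁.trans ε₂.symm).surjective.exists]
        simp only [← map_pow, (ε₁.trans ε₂.symm).injective.eq_iff]
end

section
/- Let A be a real Baer von Neumann regular poring. If there exists p ∈ Spec A such that p is an isolated point of Spec A (with the Zariski topology) and more than one prime cone α ∈ Sper A satisfies supp(α) = p, then A does not have a unique real closure *. -/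
universe u

section IdempotentQuotient

variable {A B : Type*} [CommRing A] [CommRing B]

lemma mem_span_singleton_iff_of_mul_self {e : A} (he : e * e = e) (x : A) :
    x ∈ Ideal.span {e} ↔ (1 - e) * x = 0 := by
  rw [Ideal.mem_span_singleton']
  constructor
  · rintro ⟨c, rfl⟩
    linear_combination -c * he
  · intro h
    exact ⟨x, by linear_combination -h⟩

lemma IsRealRing.quotient_span_singleton (hA : IsRealRing A) {e : A} (he : e * e = e) :
    IsRealRing (A ⧸ Ideal.span {e}) := by
  intro n f hf i
  choose g hg using fun i => Ideal.Quotient.mk_surjective (f i)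
  obtain rfl : f = fun i => Ideal.Quotient.mk _ (g i) := funext fun i => (hg i).symm
  simp only [← map_pow, ← map_sum] at hf
  rw [Ideal.Quotient.eq_zero_iff_mem, mem_span_singleton_iff_of_mul_self he] at hf
  rw [Ideal.Quotient.eq_zero_iff_mem, mem_span_singleton_iff_of_mul_self he]
  refine hA n (fun i => (1 - e) * g i) ?_ i
  have : ∀ i, ((1 - e) * g i) ^ 2 = (1 - e) * g i ^ 2 := fun i => by
    linear_combination (g i) ^ 2 * he
  simp only [this, ← Finset.mul_sum, hf]

lemma IsRealRing.prod (hA : IsRealRing A) (hB : IsRealRing B) : IsRealRing (A × B) := by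
  intro n f hf i
  ext
  · exact hA n (fun i => (f i).1) (by simpa [Prod.fst_sum] using congrArg Prod.fst hf) i
  · exact hB n (fun i => (f i).2) (by simpa [Prod.snd_sum] using congrArg Prod.snd hf) i

lemma RingHom.IsIntegral.prod {C : Type*} [CommRing C] {f : A →+* B} {g : A →+* C}
    (hf : f.IsIntegral) (hg : g.IsIntegral) : (f.prod g).IsIntegral := by
  algebraize [f, g]
  have := (inferInstance : Algebra.IsIntegral A (B × C))
  exact fun x => this.isIntegral x

end IdempotentQuotient

lemma IsRealClosedStar.quotient_span_singleton {B : Type u} [CommRing B]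
    (hB : IsRealClosedStar B) {e : B} (he : e * e = e) :
    IsRealClosedStar (B ⧸ Ideal.span {e}) := by
  refine ⟨hB.1.quotient_span_singleton he, fun C _ g hC hg hint => ?_⟩
  have he' : (1 - e) * (1 - e) = 1 - e := by linear_combination he
  let h : B →+* (B ⧸ Ideal.span {1 - e}) × C :=
    (Ideal.Quotient.mk _).prod (g.comp (Ideal.Quotient.mk _))
  have hinj : Function.Injective h := by
    rw [injective_iff_map_eq_zero]
    intro b hb
    have h1 : Ideal.Quotient.mk (Ideal.span {1 - e}) b = 0 := congrArg Prod.fst hb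
    have h2 : g (Ideal.Quotient.mk (Ideal.span {e}) b) = 0 := congrArg Prod.snd hb
    rw [map_eq_zero_iff g hg.1, Ideal.Quotient.eq_zero_iff_mem,
      mem_span_singleton_iff_of_mul_self he] at h2
    rw [Ideal.Quotient.eq_zero_iff_mem, mem_span_singleton_iff_of_mul_self he'] at h1
    linear_combination h1 + h2
  have hess : IsEssentialExtension h := by
    refine ⟨hinj, fun J hJ => ?_⟩
    obtain ⟨⟨x, y⟩, hz, hz0⟩ := Submodule.exists_mem_ne_zero_of_ne_bot hJ
    by_cases hy : y = 0
    · subst hy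
      obtain ⟨b, rfl⟩ := Ideal.Quotient.mk_surjective x
      have : h (e * b) = (Ideal.Quotient.mk _ b, 0) := by
        ext
        · change Ideal.Quotient.mk _ (e * b) = Ideal.Quotient.mk _ b
          rw [Ideal.Quotient.eq, mem_span_singleton_iff_of_mul_self he']
          linear_combination b * he
        · change g (Ideal.Quotient.mk _ (e * b)) = 0
          rw [map_eq_zero_iff g hg.1, Ideal.Quotient.eq_zero_iff_mem,
            mem_span_singleton_iff_of_mul_self he]
          linear_combination -b * he
      exact ⟨e * b, this ▸ hz, this ▸ hz0⟩
    · obtain ⟨a, ha, ha0⟩ := hg.2 (Ideal.span {y}) (by simpa using hy)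
      obtain ⟨b, rfl⟩ := Ideal.Quotient.mk_surjective a
      obtain ⟨c, hc⟩ := Ideal.mem_span_singleton'.1 ha
      have : h ((1 - e) * b) = (0, c) * (x, y) := by
        ext
        · change Ideal.Quotient.mk _ ((1 - e) * b) = 0 * x
          rw [zero_mul, Ideal.Quotient.eq_zero_iff_mem]
          exact Ideal.mul_mem_right _ _ (Ideal.mem_span_singleton_self _)
        · change g (Ideal.Quotient.mk _ ((1 - e) * b)) = c * y
          rw [hc]
          congr 1
          rw [Ideal.Quotient.eq, mem_span_singleton_iff_of_mul_self he]
          linear_combination b * he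
      refine ⟨_, this ▸ J.mul_mem_left _ hz, fun h0 => ha0 ?_⟩
      rw [h0] at this
      rw [← hc]
      exact (congrArg Prod.snd this).symm
  have hi : h.IsIntegral :=
    (RingHom.isIntegral_of_surjective _ Ideal.Quotient.mk_surjective).prod
      ((RingHom.isIntegral_of_surjective _ Ideal.Quotient.mk_surjective).trans _ _ hint)
  have hsurj := hB.2 _ h ((hB.1.quotient_span_singleton he').prod hC) hess hi
  intro c
  obtain ⟨b, hb⟩ := hsurj (0, c)
  exact ⟨Ideal.Quotient.mk _ b, congrArg Prod.snd hb⟩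

lemma IsRealClosedStar.exists_sub_mem_span {A R C : Type u} [CommRing A] [CommRing R]
    [CommRing C] (hR : IsRealClosedStar R) {e : A} (he : e * e = e) (π : A →+* R)
    (hπ : Function.Surjective π) (hker : ∀ a, π a = 0 ↔ (1 - e) * a = 0)
    (hC : IsRealRing C) (g : A →+* C) (hg : IsEssentialExtension g) (hint : g.IsIntegral)
    (c : C) : ∃ a, (1 - g e) * (g a - c) = 0 := by
  have hge : g e * g e = g e := by rw [← map_mul, he]
  have hzero : ∀ a, Ideal.Quotient.mk (Ideal.span {g e}) (g a) = 0 ↔ π a = 0 := by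
    intro a
    rw [Ideal.Quotient.eq_zero_iff_mem, mem_span_singleton_iff_of_mul_self hge, hker,
      ← map_one g, ← map_sub, ← map_mul, map_eq_zero_iff g hg.1]
  let k : R →+* C ⧸ Ideal.span {g e} :=
    π.liftOfSurjective hπ ⟨(Ideal.Quotient.mk _).comp g, fun a ha => (hzero a).2 ha⟩
  have hk : ∀ a, k (π a) = Ideal.Quotient.mk _ (g a) := fun a =>
    π.liftOfRightInverse_comp_apply _ _ _ a
  have hess : IsEssentialExtension k := by
    constructor
    · rw [injective_iff_map_eq_zero]
      intro r hr
      obtain ⟨a, rfl⟩ := hπ r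
      rwa [hk, hzero] at hr
    · intro J hJ
      obtain ⟨z, hz, hz0⟩ := Submodule.exists_mem_ne_zero_of_ne_bot hJ
      obtain ⟨c, rfl⟩ := Ideal.Quotient.mk_surjective z
      rw [Ne, Ideal.Quotient.eq_zero_iff_mem, mem_span_singleton_iff_of_mul_self hge] at hz0
      obtain ⟨a, ha, ha0⟩ := hg.2 (Ideal.span {(1 - g e) * c}) (by simpa using hz0)
      obtain ⟨d, hd⟩ := Ideal.mem_span_singleton'.1 ha
      refine ⟨π a, ?_, ?_⟩
      · have : k (π a) = Ideal.Quotient.mk _ d * Ideal.Quotient.mk _ c := by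
          rw [hk, ← map_mul, Ideal.Quotient.eq, mem_span_singleton_iff_of_mul_self hge, ← hd]
          linear_combination d * c * hge
        rw [this]
        exact J.mul_mem_left _ hz
      · rw [hk, Ne, Ideal.Quotient.eq_zero_iff_mem, mem_span_singleton_iff_of_mul_self hge]
        intro h0
        apply ha0
        rw [← hd] at h0 ⊢
        linear_combination h0 - d * c * hge
  have hi : k.IsIntegral := by
    refine RingHom.IsIntegral.tower_top π k ?_
    have : k.comp π = (Ideal.Quotient.mk _).comp g := RingHom.ext hk
    rw [this]
    exact hint.trans _ _ (RingHom.isIntegral_of_surjective _ Ideal.Quotient.mk_surjective)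
  obtain ⟨r, hr⟩ := hR.2 _ k (hC.quotient_span_singleton hge) hess hi (Ideal.Quotient.mk _ c)
  obtain ⟨a, rfl⟩ := hπ r
  refine ⟨a, ?_⟩
  rwa [hk, Ideal.Quotient.eq, mem_span_singleton_iff_of_mul_self hge] at hr

lemma IsRealClosedStar.prod {R S : Type u} [CommRing R] [CommRing S]
    (hR : IsRealClosedStar R) (hS : IsRealClosedStar S) : IsRealClosedStar (R × S) := by
  refine ⟨hR.1.prod hS.1, fun C _ g hC hg hint c => ?_⟩
  obtain ⟨a, ha⟩ := hR.exists_sub_mem_span (e := ((0, 1) : R × S)) (by simp) (RingHom.fst R S)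
    Prod.fst_surjective (by simp [Prod.ext_iff]) hC g hg hint c
  obtain ⟨b, hb⟩ := hS.exists_sub_mem_span (e := ((1, 0) : R × S)) (by simp) (RingHom.snd R S)
    Prod.snd_surjective (by simp [Prod.ext_iff]) hC g hg hint c
  have h1 : g (0, 1) + g (1, 0) = 1 := by
    rw [← map_add]
    simp [← Prod.one_eq_mk]
  refine ⟨(1, 0) * a + (0, 1) * b, ?_⟩
  rw [map_add, map_mul, map_mul]
  linear_combination ha + hb + (g a + g b - c) * h1

section WeightedReal

variable {K L : Type*} [Field K] [Field L] [Algebra K L]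

/-- A subalgebra `E` is real with respect to a set `T` of scalars if a sum of squares of elements
of `E` with weights in `T` vanishes only if each term vanishes. -/
def IsWeightedReal (T : Set K) (E : Subalgebra K L) : Prop :=
  ∀ (ι : Type) [Fintype ι] (t : ι → K) (x : ι → L), (∀ i, t i ∈ T) → (∀ i, x i ∈ E) →
    ∑ i, algebraMap K L (t i) * x i ^ 2 = 0 → ∀ i, algebraMap K L (t i) * x i ^ 2 = 0

lemma IsTotalOrderingCone.zero_mem {T : Set K} (hT : IsTotalOrderingCone T) : (0 : K) ∈ T := by
  simpa using hT.2.2.1 0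

lemma IsTotalOrderingCone.sq_mem {T : Set K} (hT : IsTotalOrderingCone T) (x : K) :
    x ^ 2 ∈ T := by
  rcases hT.2.2.1 x with h | h
  · simpa [sq] using hT.2.1 _ h _ h
  · simpa [sq] using hT.2.1 _ h _ h

lemma IsTotalOrderingCone.one_mem {T : Set K} (hT : IsTotalOrderingCone T) : (1 : K) ∈ T := by
  simpa using hT.sq_mem 1

lemma IsTotalOrderingCone.sum_mem {T : Set K} (hT : IsTotalOrderingCone T) {ι : Type*}
    (s : Finset ι) (f : ι → K) (hf : ∀ i ∈ s, f i ∈ T) : ∑ i ∈ s, f i ∈ T :=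
  Finset.sum_induction f (· ∈ T) (fun a b ha hb => hT.1 a ha b hb) hT.zero_mem hf

lemma IsTotalOrderingCone.isWeightedReal_bot {T : Set K} (hT : IsTotalOrderingCone T) :
    IsWeightedReal T (⊥ : Subalgebra K L) := by
  classical
  intro ι _ t x ht hx h i
  choose y hy using fun i => Algebra.mem_bot.1 (hx i)
  simp only [← hy, ← map_pow, ← map_mul, ← map_sum] at h ⊢
  rw [map_eq_zero] at h ⊢
  have hmem : ∀ j, t j * y j ^ 2 ∈ T := fun j => hT.2.1 _ (ht j) _ (hT.sq_mem _)
  refine hT.2.2.2 _ (hmem i) ?_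
  rw [← Finset.add_sum_erase _ _ (Finset.mem_univ i)] at h
  rw [neg_eq_of_add_eq_zero_right h]
  exact hT.sum_mem _ _ fun j _ => hmem j

lemma IsTotalOrderingCone.exists_maximal_isWeightedReal {T : Set K}
    (hT : IsTotalOrderingCone T) : ∃ E : Subalgebra K L, Maximal (IsWeightedReal T) E := by
  suffices h : ∀ c ⊆ {E : Subalgebra K L | IsWeightedReal T E}, IsChain (· ≤ ·) c →
      ∀ E₀ ∈ c, ∃ M ∈ {E : Subalgebra K L | IsWeightedReal T E}, ∀ E ∈ c, E ≤ M by
    obtain ⟨E, -, hE⟩ := zorn_le_nonempty₀ _ h ⊥ hT.isWeightedReal_bot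
    exact ⟨E, hE⟩
  intro c hc hch E₀ hE₀
  have : Nonempty c := ⟨⟨E₀, hE₀⟩⟩
  have hdir : Directed (· ≤ ·) (fun E : c => (E : Subalgebra K L)) := hch.directed
  refine ⟨⨆ E : c, (E : Subalgebra K L), ?_, fun E hE => le_iSup (fun E : c => E.1) ⟨E, hE⟩⟩
  intro ι _ t x ht hx h
  have hx' : ∀ i, ∃ E : c, x i ∈ (E : Subalgebra K L) := fun i => by
    have := hx i
    rwa [← SetLike.mem_coe, Subalgebra.coe_iSup_of_directed hdir, Set.mem_iUnion] at this
  choose F hF using hx'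
  obtain ⟨M, hM⟩ := hdir.finite_le F
  exact hc M.2 ι t x ht (fun i => hM i (hF i)) h

/-- The subalgebra `E[s]` for a square root `s` of a scalar `t`. -/
def Subalgebra.adjoinSqrt (E : Subalgebra K L) (s : L) (t : K) (hs : s ^ 2 = algebraMap K L t) :
    Subalgebra K L where
  carrier := {z | ∃ x ∈ E, ∃ y ∈ E, z = x + y * s}
  add_mem' := by
    rintro _ _ ⟨a, ha, b, hb, rfl⟩ ⟨c, hc, d, hd, rfl⟩
    exact ⟨a + c, add_mem ha hc, b + d, add_mem hb hd, by ring⟩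
  mul_mem' := by
    rintro _ _ ⟨a, ha, b, hb, rfl⟩ ⟨c, hc, d, hd, rfl⟩
    exact ⟨a * c + b * d * algebraMap K L t,
      add_mem (mul_mem ha hc) (mul_mem (mul_mem hb hd) (E.algebraMap_mem t)),
      a * d + b * c, add_mem (mul_mem ha hd) (mul_mem hb hc), by rw [← hs]; ring⟩
  algebraMap_mem' r := ⟨_, E.algebraMap_mem r, 0, zero_mem _, by simp⟩

lemma Subalgebra.inv_mem_of_isAlgebraic [Algebra.IsAlgebraic K L] (E : Subalgebra K L) {x : L}
    (hx : x ∈ E) : x⁻¹ ∈ E :=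
  E.inv_mem_of_algebraic (x := ⟨x, hx⟩) (Algebra.IsAlgebraic.isAlgebraic x)

lemma IsTotalOrderingCone.sqrt_mem_of_maximal [Algebra.IsAlgebraic K L] {T : Set K}
    (hT : IsTotalOrderingCone T) {E : Subalgebra K L} (hE : Maximal (IsWeightedReal T) E)
    {t : K} (ht : t ∈ T) {s : L} (hs : s ^ 2 = algebraMap K L t) : s ∈ E := by
  by_contra hsE
  have ht0 : algebraMap K L t ≠ 0 := by
    rintro h
    rw [h, sq_eq_zero_iff] at hs
    exact hsE (hs ▸ E.zero_mem)
  have hindep : ∀ x ∈ E, ∀ y ∈ E, x + y * s = 0 → x = 0 := by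
    intro x hx y hy h
    by_cases hy0 : y = 0
    · simpa [hy0] using h
    · refine absurd ?_ hsE
      have : s = -x * y⁻¹ := by
        field_simp
        linear_combination h
      rw [this]
      exact mul_mem (neg_mem hx) (E.inv_mem_of_isAlgebraic hy)
  have hle : E ≤ E.adjoinSqrt s t hs := fun x hx => ⟨x, hx, 0, E.zero_mem, by simp⟩
  refine hsE (hE.2 ?_ hle ⟨0, E.zero_mem, 1, E.one_mem, by simp⟩)
  intro ι _ u z hu hz h
  choose x hx y hy hxy using hz
  have hsum : (∑ i, algebraMap K L (u i) * x i ^ 2 + ∑ i, algebraMap K L (t * u i) * y i ^ 2) +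
      (∑ i, 2 * algebraMap K L (u i) * x i * y i) * s = 0 := by
    rw [← h, ← Finset.sum_add_distrib, Finset.sum_mul, ← Finset.sum_add_distrib]
    refine Finset.sum_congr rfl fun i _ => ?_
    rw [hxy, map_mul, ← hs]
    ring
  have hmemK : ∀ k : K, algebraMap K L k ∈ E := E.algebraMap_mem
  have h0 := hindep _
    (add_mem (E.sum_mem fun i _ => mul_mem (hmemK _) (pow_mem (hx i) 2))
      (E.sum_mem fun i _ => mul_mem (hmemK _) (pow_mem (hy i) 2))) _
    (E.sum_mem fun i _ => mul_mem (mul_mem (mul_mem (by simp) (hmemK _)) (hx i))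
      (hy i)) hsum
  have key := hE.1 (ι ⊕ ι) (Sum.elim u fun i => t * u i) (Sum.elim x y)
    (by rintro (i | i); exacts [hu i, hT.2.1 _ ht _ (hu i)])
    (by rintro (i | i); exacts [hx i, hy i])
    (by simpa only [Fintype.sum_sum_type, Sum.elim_inl, Sum.elim_inr] using h0)
  intro i
  have h1 := key (Sum.inl i)
  have h2 := key (Sum.inr i)
  simp only [Sum.elim_inl, Sum.elim_inr, map_mul, mul_assoc] at h1 h2
  rcases eq_or_ne (algebraMap K L (u i)) 0 with hu0 | hu0
  · simp [hu0]
  · have hx0 : x i = 0 := by simpa [hu0] using h1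
    have hy0 : y i = 0 := by simpa [hu0, ht0] using h2
    simp [hxy, hx0, hy0]

lemma IsWeightedReal.isRealRing {T : Set K} (h1 : (1 : K) ∈ T) {E : Subalgebra K L}
    (hE : IsWeightedReal T E) : IsRealRing E := by
  intro n f hf i
  have h := hE (Fin n) (fun _ => 1) (fun i => f i) (fun _ => h1) (fun i => (f i).2)
    (by simpa using congrArg Subtype.val hf) i
  ext
  simpa using h

end WeightedReal

lemma IsEssentialExtension.isField {F C : Type*} [CommRing F] [CommRing C] (hF : IsField F)
    {f : F →+* C} (hf : IsEssentialExtension f) : IsField C := by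
  let := hF.toField
  have : Nontrivial C := hf.1.nontrivial
  refine ⟨exists_pair_ne C, mul_comm, fun {c} hc => ?_⟩
  obtain ⟨a, ha, ha0⟩ := hf.2 (Ideal.span {c}) (by simpa using hc)
  obtain ⟨d, hd⟩ := Ideal.mem_span_singleton'.1 ha
  obtain ⟨b, hb⟩ := hF.mul_inv_cancel (a := a) (by rintro rfl; simp at ha0)
  exact ⟨d * f b, by rw [← mul_assoc, mul_comm c, hd, ← map_mul, hb, map_one]⟩

lemma IsTotalOrderingCone.isRealClosedStar_of_maximal {K L : Type u} [Field K] [Field L]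
    [Algebra K L] [IsAlgClosed L] [Algebra.IsAlgebraic K L] {T : Set K}
    (hT : IsTotalOrderingCone T) {E : Subalgebra K L} (hE : Maximal (IsWeightedReal T) E) :
    IsRealClosedStar E := by
  refine ⟨hE.1.isRealRing hT.one_mem, fun C _ f hC hf hint c => ?_⟩
  let : Field E := (Subalgebra.isField_of_algebraic E).toField
  let : Field C := (hf.isField (Subalgebra.isField_of_algebraic E)).toField
  let : Algebra E C := f.toAlgebra
  have : Algebra.IsIntegral E C := ⟨hint⟩
  have : Algebra.IsAlgebraic E C := inferInstance
  let g : C →ₐ[E] L := IsAlgClosed.lift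
  have hgE : ∀ x : E, g (f x) = x := fun x => g.commutes x
  have hle : E ≤ g.range.restrictScalars K := fun x hx => ⟨f ⟨x, hx⟩, hgE ⟨x, hx⟩⟩
  have hmax : g c ∈ E := by
    refine hE.2 ?_ hle ⟨c, rfl⟩
    intro ι _ t x ht hx h i
    choose y hy using hx
    choose s hs using fun i => IsAlgClosed.exists_pow_nat_eq (algebraMap K L (t i)) two_pos
    have hsE : ∀ i, s i ∈ E := fun i => hT.sqrt_mem_of_maximal hE (ht i) (hs i)
    have hterm : ∀ i, algebraMap K L (t i) * x i ^ 2 = g ((f ⟨s i, hsE i⟩ * y i) ^ 2) := by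
      intro i
      rw [map_pow, map_mul, hgE, ← hs, ← hy]
      simp [mul_pow]
    simp only [hterm, ← map_sum] at h ⊢
    rw [map_eq_zero_iff g g.injective] at h ⊢
    rw [← (Fintype.equivFin ι).symm.sum_comp] at h
    have := hC _ _ h (Fintype.equivFin ι i)
    rw [Equiv.symm_apply_apply] at this
    rw [this, zero_pow two_ne_zero]
  exact ⟨⟨g c, hmax⟩, g.injective (hgE _)⟩

/-- A totally ordered field has an algebraic extension field which is real closed * and in which
precisely the nonnegative elements become squares. -/
lemma IsTotalOrderingCone.exists_isRealClosedStar {K : Type u} [Field K] {T : Set K}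
    (hT : IsTotalOrderingCone T) :
    ∃ (R : Type u) (_ : CommRing R) (ι : K →+* R), IsField R ∧ ι.IsIntegral ∧
      IsRealClosedStar R ∧ ∀ x, x ∈ T ↔ ∃ y, y ^ 2 = ι x := by
  obtain ⟨E, hE⟩ := hT.exists_maximal_isWeightedReal (L := AlgebraicClosure K)
  have hreal := hE.1.isRealRing hT.one_mem
  have hsq : ∀ x ∈ T, ∃ y : E, y ^ 2 = algebraMap K E x := by
    intro x hx
    obtain ⟨s, hs⟩ := IsAlgClosed.exists_pow_nat_eq (algebraMap K (AlgebraicClosure K) x) two_pos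
    exact ⟨⟨s, hT.sqrt_mem_of_maximal hE hx hs⟩, Subtype.ext hs⟩
  refine ⟨E, inferInstance, algebraMap K E, Subalgebra.isField_of_algebraic E, ?_,
    hT.isRealClosedStar_of_maximal hE, fun x => ⟨hsq x, ?_⟩⟩
  · intro x
    exact (isIntegral_algHom_iff E.val Subtype.val_injective).1
      (Algebra.IsIntegral.isIntegral (R := K) (x : AlgebraicClosure K))
  · rintro ⟨y, hy⟩
    refine (hT.2.2.1 x).elim id fun hx => ?_
    obtain ⟨z, hz⟩ := hsq _ hx
    have hy0 : y = 0 := hreal 2 ![y, z] (by simp [hy, hz]) 0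
    have : x = 0 := by
      rw [hy0, zero_pow two_ne_zero] at hy
      exact (map_eq_zero (algebraMap K E)).1 hy.symm
    exact this ▸ hT.zero_mem

lemma IsSumSq.exists_sum_fin {R : Type*} [CommRing R] {a : R} (ha : IsSumSq a) :
    ∃ (n : ℕ) (f : Fin n → R), a = ∑ i, f i ^ 2 := by
  induction ha with
  | zero => exact ⟨0, Fin.elim0, by simp⟩
  | sq_add x _ ih =>
    obtain ⟨n, f, rfl⟩ := ih
    exact ⟨n + 1, Fin.cons x f, by simp [Fin.sum_univ_succ, sq]⟩

lemma IsRealRing.isPartialOrdering_isSumSq {R : Type*} [CommRing R] (hR : IsRealRing R) :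
    IsPartialOrdering {x : R | IsSumSq x} := by
  refine ⟨fun a ha b hb => ha.add hb, fun a ha b hb => ha.mul hb,
    fun a => by simp [sq, IsSumSq.mul_self], fun a ha hna => ?_⟩
  obtain ⟨n, f, hf⟩ := ha.exists_sum_fin
  obtain ⟨m, g, hg⟩ := hna.exists_sum_fin
  have h := hR (n + m) (Fin.append f g) (by simp [Fin.sum_univ_add, ← hf, ← hg])
  rw [hf]
  exact Finset.sum_eq_zero fun i _ => by
    have := h (Fin.castAdd m i)
    rw [Fin.append_left] at this
    rw [this, zero_pow two_ne_zero]

lemma IsPartialOrdering.quotient_span_singleton {B : Type*} [CommRing B] {Q : Set B}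
    (hQ : IsPartialOrdering Q) {e : B} (he : e * e = e) :
    IsPartialOrdering (Ideal.Quotient.mk (Ideal.span {e}) '' Q) := by
  refine ⟨?_, ?_, ?_, ?_⟩
  · rintro _ ⟨a, ha, rfl⟩ _ ⟨b, hb, rfl⟩
    exact ⟨a + b, hQ.1 a ha b hb, map_add _ _ _⟩
  · rintro _ ⟨a, ha, rfl⟩ _ ⟨b, hb, rfl⟩
    exact ⟨a * b, hQ.2.1 a ha b hb, map_mul _ _ _⟩
  · intro z
    obtain ⟨a, rfl⟩ := Ideal.Quotient.mk_surjective z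
    exact ⟨a ^ 2, hQ.2.2.1 a, map_pow _ _ _⟩
  · rintro _ ⟨a, ha, rfl⟩ ⟨b, hb, hab⟩
    rw [← map_neg, Ideal.Quotient.eq, mem_span_singleton_iff_of_mul_self he] at hab
    rw [Ideal.Quotient.eq_zero_iff_mem, mem_span_singleton_iff_of_mul_self he]
    have h1 : (1 - e) ∈ Q := by
      have := hQ.2.2.1 (1 - e)
      rwa [show (1 - e) ^ 2 = 1 - e by linear_combination he] at this
    refine hQ.2.2.2 _ (hQ.2.1 _ h1 _ ha) ?_
    rw [show -((1 - e) * a) = (1 - e) * b by linear_combination -hab]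
    exact hQ.2.1 _ h1 _ hb

lemma IsPartialOrdering.prod {R S : Type*} [CommRing R] [CommRing S] {P : Set R} {Q : Set S}
    (hP : IsPartialOrdering P) (hQ : IsPartialOrdering Q) : IsPartialOrdering (P ×ˢ Q) :=
  ⟨fun _ ha _ hb => ⟨hP.1 _ ha.1 _ hb.1, hQ.1 _ ha.2 _ hb.2⟩,
    fun _ ha _ hb => ⟨hP.2.1 _ ha.1 _ hb.1, hQ.2.1 _ ha.2 _ hb.2⟩,
    fun a => ⟨hP.2.2.1 a.1, hQ.2.2.1 a.2⟩,
    fun _ ha hna => Prod.ext (hP.2.2.2 _ ha.1 hna.1) (hQ.2.2.2 _ ha.2 hna.2)⟩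

section PrimeCone

variable {A : Type u} [CommRing A] (γ : PrimeCone A) {K : Type*} [CommRing K] {φ : A →+* K}

lemma PrimeCone.map_mem_image_iff (hker : RingHom.ker φ = γ.support) (a : A) :
    φ a ∈ φ '' γ.carrier ↔ a ∈ γ.carrier := by
  refine ⟨?_, fun h => ⟨a, h, rfl⟩⟩
  rintro ⟨b, hb, hab⟩
  have : a - b ∈ γ.support := by
    rw [← hker, RingHom.mem_ker, map_sub, hab, sub_self]
  simpa using γ.add_mem _ ((γ.mem_support _).1 this).1 _ hb

lemma PrimeCone.isTotalOrderingCone_image (hφ : Function.Surjective φ)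
    (hker : RingHom.ker φ = γ.support) : IsTotalOrderingCone (φ '' γ.carrier) := by
  refine ⟨?_, ?_, ?_, ?_⟩
  · rintro _ ⟨a, ha, rfl⟩ _ ⟨b, hb, rfl⟩
    exact ⟨a + b, γ.add_mem a ha b hb, map_add _ _ _⟩
  · rintro _ ⟨a, ha, rfl⟩ _ ⟨b, hb, rfl⟩
    exact ⟨a * b, γ.mul_mem a ha b hb, map_mul _ _ _⟩
  · intro x
    obtain ⟨a, rfl⟩ := hφ x
    rw [← map_neg, γ.map_mem_image_iff hker, γ.map_mem_image_iff hker]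
    exact γ.mem_or_neg_mem a
  · intro x hx hnx
    obtain ⟨a, rfl⟩ := hφ x
    rw [← map_neg] at hnx
    rw [γ.map_mem_image_iff hker] at hx hnx
    rw [← RingHom.mem_ker, hker, γ.mem_support]
    exact ⟨hx, hnx⟩

end PrimeCone

/-- Given a real closure * of `(A, P)` and an idempotent `e` cutting out a field factor `K` of `A`,
the corresponding factor of the real closure * can be replaced by a real closure of `K` with respect
to any prime cone supported on the kernel of `A → K`. -/
lemma RealClosureStar.exists_mem_iff_isSquare {A : Type u} [CommRing A] {P : Set A}
    (B : RealClosureStar A P) {K : Type u} [Field K] {φ : A →+* K} (hφ : Function.Surjective φ)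
    {e : A} (he : e * e = e) (hφe : ∀ a, φ a = 0 ↔ e * a = 0) (γ : RealSpectrum A P)
    (hker : RingHom.ker φ = γ.1.support) :
    ∃ C : RealClosureStar A P, ∀ a, a ∈ γ.1.carrier ↔ ∃ y, y ^ 2 = C.emb (e * a) := by
  obtain ⟨B, Q, f, hQ, hrcs, hess, hint, hmono⟩ := B
  obtain ⟨R, _, ι, hR, hι, hRrcs, hιsq⟩ :=
    (γ.1.isTotalOrderingCone_image hφ hker).exists_isRealClosedStar
  have : Nontrivial R := hR.nontrivial
  have hιinj : Function.Injective ι := ι.injective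
  have hfe : f e * f e = f e := by rw [← map_mul, he]
  have hφ1 : φ e = 1 := by
    rw [← sub_eq_zero, ← map_one φ, ← map_sub, hφe]
    linear_combination he
  let q : B →+* B ⧸ Ideal.span {f e} := Ideal.Quotient.mk _
  have hq : ∀ b, q b = 0 ↔ (1 - f e) * b = 0 := fun b => by
    rw [Ideal.Quotient.eq_zero_iff_mem, mem_span_singleton_iff_of_mul_self hfe]
  have hqf : ∀ a, q (f a) = 0 ↔ (1 - e) * a = 0 := fun a => by
    rw [hq, ← map_one f, ← map_sub, ← map_mul, map_eq_zero_iff f hess.1]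
  have hιφ : ∀ a, ι (φ a) = 0 ↔ e * a = 0 := fun a => by rw [map_eq_zero_iff ι hιinj, hφe]
  let h : A →+* R × (B ⧸ Ideal.span {f e}) := (ι.comp φ).prod (q.comp f)
  have hhe : ∀ a, h (e * a) = (ι (φ a), 0) := fun a =>
    Prod.ext (by simp [h, hφ1]) ((hqf _).2 (by linear_combination -a * he))
  have hinj : Function.Injective h := by
    rw [injective_iff_map_eq_zero]
    intro a ha
    have h1 := (hιφ a).1 (congrArg Prod.fst ha)
    have h2 := (hqf a).1 (congrArg Prod.snd ha)
    linear_combination h1 + h2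
  have hh : IsRealClosureStarOf A P (R × (B ⧸ Ideal.span {f e})) ({x | IsSumSq x} ×ˢ (q '' Q)) h :=
    { pos_partial :=
        hRrcs.1.isPartialOrdering_isSumSq.prod (hQ.quotient_span_singleton hfe)
      rcs := hRrcs.prod (hrcs.quotient_span_singleton hfe)
      essential := by
        refine ⟨hinj, fun J hJ => ?_⟩
        obtain ⟨⟨x, y⟩, hz, hz0⟩ := Submodule.exists_mem_ne_zero_of_ne_bot hJ
        by_cases hx : x = 0
        · subst hx
          obtain ⟨b, rfl⟩ := Ideal.Quotient.mk_surjective y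
          have hb : (1 - f e) * b ≠ 0 := fun hb => hz0 (Prod.ext rfl ((hq b).2 hb))
          obtain ⟨a, ha, ha0⟩ := hess.2 (Ideal.span {(1 - f e) * b}) (by simpa using hb)
          obtain ⟨c, hc⟩ := Ideal.mem_span_singleton'.1 ha
          refine ⟨a, ?_, fun h0 => ha0 ?_⟩
          · have : h a = (0, q c) * (0, q b) := by
              refine Prod.ext ?_ ?_
              · change ι (φ a) = 0 * 0
                rw [mul_zero, hιφ]
                apply hess.1
                rw [map_mul, ← hc, map_zero]
                linear_combination -c * b * hfe
              · change q (f a) = q c * q b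
                rw [← map_mul, ← sub_eq_zero, ← map_sub, hq, ← hc]
                linear_combination c * b * hfe
            rw [this]
            exact J.mul_mem_left _ hz
          · rw [(map_eq_zero_iff h hinj).1 h0, map_zero]
        · obtain ⟨x', hx'⟩ := hR.mul_inv_cancel hx
          have : h (e * 1) = (x', 0) * (x, y) := by
            rw [hhe, map_one, map_one, Prod.mk_mul_mk, mul_comm x', hx', zero_mul]
          refine ⟨e * 1, this ▸ J.mul_mem_left _ hz, ?_⟩
          rw [hhe, map_one, map_one]
          exact fun h0 => one_ne_zero (congrArg Prod.fst h0)
      integral := ((RingHom.isIntegral_of_surjective _ hφ).trans _ _ hι).prod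
        (hint.trans _ _ (RingHom.isIntegral_of_surjective _ Ideal.Quotient.mk_surjective))
      mono := fun a ha => by
        refine ⟨?_, f a, hmono a ha, rfl⟩
        obtain ⟨y, hy⟩ := (hιsq (φ a)).1 ⟨a, γ.2 ha, rfl⟩
        change IsSumSq (ι (φ a))
        rw [← hy, sq]
        exact IsSumSq.mul_self y }
  refine ⟨⟨_, _, h, hh⟩, fun a => ?_⟩
  rw [← γ.1.map_mem_image_iff hker, hιsq]
  change _ ↔ ∃ y, y ^ 2 = h (e * a)
  rw [hhe]
  constructor
  · rintro ⟨y, hy⟩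
    exact ⟨(y, 0), by simp [← hy]⟩
  · rintro ⟨y, hy⟩
    exact ⟨y.1, congrArg Prod.fst hy⟩

lemma IsVonNeumannRegular.isMaximal_s10 {A : Type*} [CommRing A] (hA : IsVonNeumannRegular A)
    (p : Ideal A) [hp : p.IsPrime] : p.IsMaximal := by
  refine Ideal.Quotient.maximal_of_isField _ ⟨⟨0, 1, zero_ne_one⟩, mul_comm, fun {x} hx => ?_⟩
  obtain ⟨a, rfl⟩ := Ideal.Quotient.mk_surjective x
  obtain ⟨b, hb⟩ := hA a
  refine ⟨Ideal.Quotient.mk _ b, mul_left_cancel₀ hx ?_⟩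
  rw [← map_mul, ← map_mul, mul_one]
  congr 1
  linear_combination -hb

lemma IsVonNeumannRegular.isReduced_s10 {A : Type*} [CommRing A] (hA : IsVonNeumannRegular A) :
    IsReduced A := by
  rw [isReduced_iff_pow_one_lt 2 one_lt_two]
  intro a ha
  obtain ⟨b, hb⟩ := hA a
  rw [hb, ha, zero_mul]

/-- An isolated point `p` of the spectrum of a von Neumann regular ring is the annihilator of an
idempotent. -/
lemma IsVonNeumannRegular.exists_idempotent_of_isOpen_singleton {A : Type*} [CommRing A]
    (hA : IsVonNeumannRegular A) {p : PrimeSpectrum A} (hp : IsOpen {p}) :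
    ∃ e : A, e * e = e ∧ ∀ a, a ∈ p.asIdeal ↔ e * a = 0 := by
  have := hA.isReduced_s10
  have hclosed : IsClosed {p} :=
    (PrimeSpectrum.isClosed_singleton_iff_isMaximal p).2 (hA.isMaximal_s10 p.asIdeal)
  obtain ⟨e, he, hpe⟩ := PrimeSpectrum.isClopen_iff.1 ⟨hclosed, hp⟩
  have hep : e ∉ p.asIdeal := by
    have : p ∈ (PrimeSpectrum.basicOpen e : Set (PrimeSpectrum A)) := hpe ▸ rfl
    exact this
  refine ⟨e, he, fun a => ⟨fun ha => ?_, fun ha => ?_⟩⟩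
  · refine IsNilpotent.eq_zero ((PrimeSpectrum.basicOpen_eq_bot_iff _).1 ?_)
    rw [eq_bot_iff]
    intro r hr
    rw [PrimeSpectrum.basicOpen_mul] at hr
    have hrp : r ∈ ({p} : Set (PrimeSpectrum A)) := hpe ▸ hr.1
    rw [Set.mem_singleton_iff] at hrp
    subst hrp
    exact hr.2 ha
  · exact (p.2.mem_or_mem (ha ▸ zero_mem _ : e * a ∈ p.asIdeal)).resolve_left hep

lemma PrimeCone.ext_of_carrier_eq {A : Type u} [CommRing A] {α β : PrimeCone A}
    (h : α.carrier = β.carrier) : α = β := by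
  have hs : α.support = β.support := by
    ext a
    rw [α.mem_support, β.mem_support, h]
  cases α
  cases β
  congr

/-- Let `(A, P)` be a real Baer von Neumann regular poring.  If some
`p ∈ Spec A` is an isolated point of `Spec A` and carries more than one prime cone
(i.e. there are distinct `α, β ∈ Sper A` with support `p`), then `A` does not have a
unique real closure *. -/
theorem not_hasUniqueRealClosureStar_of_isolated
    (A : Type u) [CommRing A] (P : Set A) (hP : IsPartialOrdering P)
    (hreal : IsRealRing A) (hBaer : IsBaerRing A) (hvnr : IsVonNeumannRegular A)
    (p : PrimeSpectrum A) (hiso : IsOpen ({p} : Set (PrimeSpectrum A)))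
    (α β : RealSpectrum A P) (hαβ : α ≠ β)
    (hα : α.1.support = p.asIdeal) (hβ : β.1.support = p.asIdeal) :
    ¬ HasUniqueRealClosureStar A P := by
  rintro ⟨⟨B⟩, huniq⟩
  have hmax : p.asIdeal.IsMaximal := hvnr.isMaximal_s10 p.asIdeal
  let : Field (A ⧸ p.asIdeal) := Ideal.Quotient.field p.asIdeal
  obtain ⟨e, he, hpe⟩ := hvnr.exists_idempotent_of_isOpen_singleton hiso
  have hφe : ∀ a, Ideal.Quotient.mk p.asIdeal a = 0 ↔ e * a = 0 := fun a => by
    rw [Ideal.Quotient.eq_zero_iff_mem, hpe]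
  obtain ⟨C, hC⟩ := B.exists_mem_iff_isSquare Ideal.Quotient.mk_surjective he hφe α
    (by rw [Ideal.mk_ker, hα])
  obtain ⟨D, hD⟩ := B.exists_mem_iff_isSquare Ideal.Quotient.mk_surjective he hφe β
    (by rw [Ideal.mk_ker, hβ])
  obtain ⟨θ, hθ, -⟩ := huniq C D
  refine hαβ (Subtype.ext (PrimeCone.ext_of_carrier_eq (Set.ext fun a => ?_)))
  rw [hC, hD, ← hθ]
  constructor
  · rintro ⟨y, hy⟩
    exact ⟨θ y, by rw [← hy, map_pow]⟩
  · rintro ⟨y, hy⟩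
    exact ⟨θ.symm y, by rw [← map_pow, hy, θ.symm_apply_apply]⟩
end
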